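/- arXiv:1312.1330 — 3 statements merged into one kernel-verified Lean document; each statement's English description precedes it below -/
import Mathlib

section
/- If R is a commutative Noetherian ring, 𝔞 an ideal of R, and M, N are finitely generated R-modules with Supp(N) ⊆ Supp(M), then cd(𝔞, N) ≤ cd(𝔞, M), where cd(𝔞, −) denotes the cohomological dimension sup{i : H^i_𝔞(−) ≠ 0}. -/
open CategoryTheory

universe u

/-- `H^i_I(M) ≠ 0`: the `i`-th local cohomology of `M` with respect to `I` is nonzero. -/
abbrev LCNonzero {R : Type u} [CommRing R] (I : Ideal R) (i : ℕ)
    (M : Type u) [AddCommGroup M] [Module R M] : Prop :=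
  Nontrivial ((localCohomology I i).obj (ModuleCat.of R M))

/-- Cohomological dimension `cd(I, M) = sup {i : H^i_I(M) ≠ 0}`, as an element of
`WithBot ℕ∞` (it is `⊥` if all local cohomology of `M` vanishes). -/
noncomputable def cohDim {R : Type u} [CommRing R] (I : Ideal R)
    (M : Type u) [AddCommGroup M] [Module R M] : WithBot ℕ∞ :=
  sSup {n : WithBot ℕ∞ | ∃ i : ℕ, n = (i : ℕ∞) ∧ LCNonzero I i M}

/-- Krull dimension of a module, i.e. the Krull dimension of `R ⧸ Ann_R M`. -/
noncomputable def modDim (R : Type u) [CommRing R]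
    (M : Type u) [AddCommGroup M] [Module R M] : WithBot ℕ∞ :=
  ringKrullDim (R ⧸ Module.annihilator R M)

namespace LCAux

open Opposite Limits

variable {R : Type u} [CommRing R]

/-- map on Hom complexes -/
noncomputable def yMap {K L : ChainComplex (ModuleCat.{u} R) ℕ} (φ : K ⟶ L) (Y : ModuleCat.{u} R) :
    L.linearYonedaObj R Y ⟶ K.linearYonedaObj R Y :=
  (HomologicalComplex.unopFunctor _ _).map
    ((((linearYoneda R (ModuleCat.{u} R)).obj Y).rightOp.mapHomologicalComplex _).map φ).op

lemma gen1 {C : Type*} [Category C] {A A' B B' D D' : C} (e : A ≅ B) (e' : A' ≅ B')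
    (h : A' ⟶ A) (k : B' ⟶ B) (h2 : h ≫ e.hom = e'.hom ≫ k) (x : A ⟶ D) (x' : A' ⟶ D')
    (m : D' ⟶ D) (h1 : x' ≫ m = h ≫ x) : (e'.inv ≫ x') ≫ m = k ≫ e.inv ≫ x := by
  rw [Category.assoc, h1, Iso.inv_comp_eq, ← Category.assoc, ← Category.assoc, ← h2]
  simp

lemma isoExt_naturality {X X' : ModuleCat.{u} R} (g : X' ⟶ X) (P' : ProjectiveResolution X')
    (P : ProjectiveResolution X) (φ : P'.complex ⟶ P.complex)
    (comm : φ.f 0 ≫ P.π.f 0 = P'.π.f 0 ≫ g) (n : ℕ) (Y : ModuleCat.{u} R) :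
    ((Ext R (ModuleCat.{u} R) n).map g.op).app Y ≫ (P'.isoExt (R := R) n Y).hom =
      (P.isoExt (R := R) n Y).hom ≫ HomologicalComplex.homologyMap (yMap φ Y) n := by
  have h1 := ProjectiveResolution.isoLeftDerivedObj_inv_naturality g P' P φ comm
    ((linearYoneda R (ModuleCat.{u} R)).obj Y).rightOp n
  have h2 := HomologicalComplex.homologyOp_hom_naturality (yMap φ Y) n
  apply Quiver.Hom.op_inj
  exact gen1 _ _ _ _ h2 _ _ _ h1

lemma yMap_f {K L : ChainComplex (ModuleCat.{u} R) ℕ} (φ : K ⟶ L) (Y : ModuleCat.{u} R) (n : ℕ)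
   (f : L.X n ⟶ Y) : ((yMap φ Y).f n).hom f = φ.f n ≫ f := rfl

lemma yd {K : ChainComplex (ModuleCat.{u} R) ℕ} (Y : ModuleCat.{u} R) (n m : ℕ)
   (f : K.X n ⟶ Y) : ((K.linearYonedaObj R Y).d n m).hom f = K.d m n ≫ f := rfl

section cyc
variable (K : CochainComplex (ModuleCat.{u} R) ℕ)

lemma homologyπ_surj (n : ℕ) : Function.Surjective (K.homologyπ n).hom :=
  (ModuleCat.epi_iff_surjective _).1 inferInstance

lemma iCycles_inj (n : ℕ) : Function.Injective (K.iCycles n).hom :=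
  (ModuleCat.mono_iff_injective _).1 inferInstance

lemma d_iCycles (n m : ℕ) (z : K.cycles n) : (K.d n m).hom ((K.iCycles n).hom z) = 0 := by
  have := K.iCycles_d n m
  exact congrArg (fun f => f.hom z) this

lemma exists_cycle (n : ℕ) (x : K.X n) (hx : (K.d n (n+1)).hom x = 0) :
    ∃ z : K.cycles n, (K.iCycles n).hom z = x := by
  have h := ShortComplex.exact_of_f_is_kernel (ShortComplex.mk (K.iCycles n) (K.d n (n+1)) (by simp))
    (K.cyclesIsKernel n (n+1) (by simp))
  rw [ShortComplex.moduleCat_exact_iff] at h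
  exact h x hx

lemma homologyπ_eq_zero_iff (n : ℕ) (z : K.cycles n) : (K.homologyπ n).hom z = 0 ↔
    ∃ y, (K.d ((ComplexShape.up ℕ).prev n) n).hom y = (K.iCycles n).hom z := by
  have h := ShortComplex.exact_of_g_is_cokernel
    (ShortComplex.mk (K.toCycles ((ComplexShape.up ℕ).prev n) n) (K.homologyπ n) (by simp))
    (K.homologyIsCokernel _ n rfl)
  rw [ShortComplex.moduleCat_exact_iff] at h
  have ht : ∀ y, (K.iCycles n).hom ((K.toCycles ((ComplexShape.up ℕ).prev n) n).hom y) = 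
    (K.d ((ComplexShape.up ℕ).prev n) n).hom y := fun y => 
     congrArg (fun f => f.hom y) (K.toCycles_i _ n)
  constructor
  · intro hz
    obtain ⟨y, hy⟩ := h z hz
    exact ⟨y, by rw [← ht]; exact congrArg _ hy⟩
  · rintro ⟨y, hy⟩
    rw [← ht] at hy
    rw [← iCycles_inj K n hy]
    exact congrArg (fun f => f.hom y) (K.toCycles_comp_homologyπ _ n)
end cyc

/-- representing cocycle -/
def Rep {X : ModuleCat.{u} R} (P : ProjectiveResolution X) (Y : ModuleCat.{u} R) (n : ℕ)
    (a : ((Ext R (ModuleCat.{u} R) n).obj (op X)).obj Y) (f : P.complex.X n ⟶ Y) : Prop :=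
  ∃ z : (P.complex.linearYonedaObj R Y).cycles n,
    ((P.complex.linearYonedaObj R Y).iCycles n).hom z = f ∧
    ((P.complex.linearYonedaObj R Y).homologyπ n).hom z = (P.isoExt n Y).hom.hom a

lemma Rep.exists_right {X : ModuleCat.{u} R} (P : ProjectiveResolution X) (Y : ModuleCat.{u} R)
    (n : ℕ) (a : ((Ext R (ModuleCat.{u} R) n).obj (op X)).obj Y) : ∃ f, Rep P Y n a f := by
  obtain ⟨z, hz⟩ := homologyπ_surj _ n ((P.isoExt n Y).hom.hom a)
  exact ⟨_, z, rfl, hz⟩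

lemma Rep.d_eq {X : ModuleCat.{u} R} {P : ProjectiveResolution X} {Y : ModuleCat.{u} R}
    {n : ℕ} {a : ((Ext R (ModuleCat.{u} R) n).obj (op X)).obj Y} {f} (h : Rep P Y n a f) (m : ℕ) :
    P.complex.d m n ≫ f = 0 := by
  obtain ⟨z, rfl, hz⟩ := h
  exact d_iCycles (P.complex.linearYonedaObj R Y) n m z

lemma Rep.exists_left {X : ModuleCat.{u} R} (P : ProjectiveResolution X) (Y : ModuleCat.{u} R)
    (n : ℕ) (f : P.complex.X n ⟶ Y) (h : P.complex.d (n+1) n ≫ f = 0) : ∃ a, Rep P Y n a f := by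
  obtain ⟨z, hz⟩ := exists_cycle (P.complex.linearYonedaObj R Y) n f h
  refine ⟨(P.isoExt n Y).inv.hom (((P.complex.linearYonedaObj R Y).homologyπ n).hom z), z, hz, ?_⟩
  exact (congrArg (fun f => f.hom (((P.complex.linearYonedaObj R Y).homologyπ n).hom z))
    (P.isoExt n Y).inv_hom_id).symm

lemma Rep.map {X X' : ModuleCat.{u} R} {P : ProjectiveResolution X} {Y : ModuleCat.{u} R}
    {n : ℕ} {a : ((Ext R (ModuleCat.{u} R) n).obj (op X)).obj Y} {f} (h : Rep P Y n a f)
    (P' : ProjectiveResolution X') (g : X' ⟶ X) (φ : ProjectiveResolution.Hom P' P g) :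
    Rep P' Y n ((((Ext R (ModuleCat.{u} R) n).map g.op).app Y).hom a) (φ.hom.f n ≫ f) := by
  have nat := isoExt_naturality g P' P φ.hom (by simpa using φ.hom_f_zero_comp_π_f_zero) n Y
  obtain ⟨z, rfl, hz⟩ := h
  refine ⟨(HomologicalComplex.cyclesMap (yMap φ.hom Y) n).hom z, ?_, ?_⟩
  · exact congrArg (fun f => f.hom z) (HomologicalComplex.cyclesMap_i (yMap φ.hom Y) n)
  · have e1 := congrArg (fun f => f.hom z) (HomologicalComplex.homologyπ_naturality (yMap φ.hom Y) n)
    have e2 := congrArg (fun f => f.hom a) nat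
    refine e1.symm.trans (Eq.trans ?_ e2.symm)
    exact congrArg (HomologicalComplex.homologyMap (yMap φ.hom Y) n).hom hz

lemma extMk_zero_iff {X : ModuleCat.{u} R} {P : ProjectiveResolution X} {Y : ModuleCat.{u} R}
    (f : P.complex.X 0 ⟶ Y) (hf) : P.extMk f 1 rfl hf = 0 ↔ f = 0 := by
  constructor
  · intro h
    rw [← P.extEquivCohomologyClass.apply_eq_iff_eq,
      P.extEquivCohomologyClass_extMk, P.extEquivCohomologyClass_zero,
      CochainComplex.HomComplex.CohomologyClass.mk_eq_zero_iff,
      CochainComplex.HomComplex.Cocycle.toSingleMk_mem_coboundaries_iff _ _ _ _ _ 1 (by simp)] at h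
    obtain ⟨g, hg⟩ := h
    have h0 : g = 0 := (CochainComplex.isZero_of_isStrictlyLE P.cochainComplex 0 1 (by simp)).eq_of_src _ _
    rw [← cancel_epi (P.cochainComplexXIso (-(0 : ℕ)) 0 rfl).hom, ← hg, h0]
    simp
  · rintro rfl
    simp

lemma Rep.zero_iff {X : ModuleCat.{u} R} {P : ProjectiveResolution X} {Y : ModuleCat.{u} R}
    {n : ℕ} {a : ((Ext R (ModuleCat.{u} R) n).obj (op X)).obj Y} {f} (h : Rep P Y n a f) :
    a = 0 ↔ P.extMk f (n+1) rfl (h.d_eq _) = 0 := by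
  obtain ⟨z, hzf, hz⟩ := id h
  have h1 : a = 0 ↔ (P.isoExt n Y).hom.hom a = 0 := by
    have : Function.Injective (P.isoExt (R := R) n Y).hom.hom :=
      (ModuleCat.mono_iff_injective _).1 inferInstance
    exact (map_eq_zero_iff _ this).symm
  have h2 := homologyπ_eq_zero_iff (P.complex.linearYonedaObj R Y) n z
  rw [hz, ← h1, hzf] at h2
  refine h2.trans ?_
  rcases n with _ | n
  · refine Iff.trans ?_ (extMk_zero_iff f (h.d_eq _)).symm
    constructor
    · rintro ⟨y, hy⟩
      rw [← hy, HomologicalComplex.shape _ _ _ (by simp)]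
      rfl
    · intro h
      exact ⟨0, by rw [map_zero]; exact h.symm⟩
  · refine Iff.trans ?_ (P.extMk_eq_zero_iff f _ rfl (h.d_eq _) n rfl).symm
    rw [CochainComplex.prev_nat_succ]
    exact Iff.rfl

lemma compare {X : ModuleCat.{u} R} (Y : ModuleCat.{u} R) (n : ℕ) 
   (a : ((Ext R (ModuleCat.{u} R) n).obj (op X)).obj Y) :
   ∃ e : Abelian.Ext X Y n, ∀ (X' : ModuleCat.{u} R) (g : X' ⟶ X),
    ((((Ext R (ModuleCat.{u} R) n).map g.op).app Y).hom a = 0 ↔ (Abelian.Ext.mk₀ g).comp e (zero_add n) = 0) := by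
  let P := projectiveResolution X
  obtain ⟨f, hf⟩ := Rep.exists_right P Y n a
  refine ⟨P.extMk f (n+1) rfl (hf.d_eq _), fun X' g => ?_⟩
  let φ : ProjectiveResolution.Hom (projectiveResolution X') P g := 
   ⟨ProjectiveResolution.lift g _ _, HomologicalComplex.congr_hom
     (ProjectiveResolution.lift_commutes g (projectiveResolution X') P) 0⟩
  rw [P.mk₀_comp_extMk _ _ _ _ φ, (hf.map _ g φ).zero_iff]

lemma compare' {X : ModuleCat.{u} R} (Y : ModuleCat.{u} R) (n : ℕ) 
   (e : Abelian.Ext X Y n) :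
   ∃ a : ((Ext R (ModuleCat.{u} R) n).obj (op X)).obj Y, ∀ (X' : ModuleCat.{u} R) (g : X' ⟶ X),
    ((((Ext R (ModuleCat.{u} R) n).map g.op).app Y).hom a = 0 ↔ (Abelian.Ext.mk₀ g).comp e (zero_add n) = 0) := by
  let P := projectiveResolution X
  obtain ⟨f, hf0, rfl⟩ := P.extMk_surjective e (n+1) rfl
  obtain ⟨a, hf⟩ := Rep.exists_left P Y n f hf0
  refine ⟨a, fun X' g => ?_⟩
  let φ : ProjectiveResolution.Hom (projectiveResolution X') P g := 
   ⟨ProjectiveResolution.lift g _ _, HomologicalComplex.congr_hom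
     (ProjectiveResolution.lift_commutes g (projectiveResolution X') P) 0⟩
  rw [P.mk₀_comp_extMk _ _ _ _ φ, (hf.map _ g φ).zero_iff]


/-- multiplication by `r` as a map of cyclic modules -/
noncomputable def mu (p q : Ideal R) (r : R) (h : ∀ x ∈ p, r * x ∈ q) :
    ModuleCat.of R (R ⧸ p) ⟶ ModuleCat.of R (R ⧸ q) :=
  ModuleCat.ofHom (Submodule.mapQ p q (LinearMap.lsmul R R r) h)

lemma mu_comp {p q s : Ideal R} {a b : R} (h h') :
    mu p q a h ≫ mu q s b h' = mu p s (b * a) (fun x hx => by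
      rw [mul_assoc]; exact h' _ (h _ hx)) := by
  refine ModuleCat.hom_ext (LinearMap.ext fun x => ?_)
  obtain ⟨x, rfl⟩ := Submodule.mkQ_surjective _ x
  change Submodule.Quotient.mk (b * (a * x)) = Submodule.Quotient.mk ((b * a) * x)
  rw [mul_assoc]

lemma mu_congr {p q : Ideal R} {a b : R} (hab : a = b) (h) :
    mu p q a h = mu p q b (hab ▸ h) := by subst hab; rfl

lemma mu_self (p : Ideal R) (h) : mu p p 1 h = 𝟙 _ := by
  refine ModuleCat.hom_ext (LinearMap.ext fun x => ?_)
  obtain ⟨x, rfl⟩ := Submodule.mkQ_surjective _ x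
  change Submodule.Quotient.mk (1 * x) = Submodule.Quotient.mk x
  rw [one_mul]

/-- projection -/
noncomputable abbrev pr {p q : Ideal R} (h : p ≤ q) :
    ModuleCat.of R (R ⧸ p) ⟶ ModuleCat.of R (R ⧸ q) :=
  mu p q 1 (fun x hx => by simpa using h hx)

lemma pr_comp {p q s : Ideal R} (h : p ≤ q) (h' : q ≤ s) : pr h ≫ pr h' = pr (h.trans h') := by
  rw [mu_comp]; exact mu_congr (one_mul 1) _

/-- pulling back Ext classes -/
noncomputable abbrev pb {X X' Y : ModuleCat.{u} R} (g : X' ⟶ X) {i : ℕ} (e : Abelian.Ext X Y i) :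
    Abelian.Ext X' Y i := (Abelian.Ext.mk₀ g).comp e (zero_add i)

lemma pb_comp {X X' X'' Y : ModuleCat.{u} R} (g' : X'' ⟶ X') (g : X' ⟶ X) {i : ℕ}
    (e : Abelian.Ext X Y i) : pb g' (pb g e) = pb (g' ≫ g) e := by
  simp [pb]

lemma pb_zero {X X' Y : ModuleCat.{u} R} (g : X' ⟶ X) {i : ℕ} : 
    pb g (0 : Abelian.Ext X Y i) = 0 := by
  simp [pb]

/-- vanishing of `colim Ext^i(R/b n, L)` -/
def Van (b : ℕ → Ideal R) (i : ℕ) (L : ModuleCat.{u} R) : Prop :=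
  ∀ n (e : Abelian.Ext (ModuleCat.of R (R ⧸ b n)) L i), ∃ m, ∃ h : b m ≤ b n, n ≤ m ∧
    pb (pr h) e = 0

/-- the diagram evaluated at `M` -/
noncomputable abbrev diagAt (I : Ideal R) (i : ℕ) (M : ModuleCat.{u} R) :
    (ℕᵒᵖ)ᵒᵖ ⥤ ModuleCat.{u} R :=
  localCohomology.diagram (localCohomology.idealPowersDiagram I) i ⋙ (evaluation _ _).obj M

noncomputable def lcIso (I : Ideal R) (i : ℕ) (M : ModuleCat.{u} R) :
    (localCohomology I i).obj M ≅ colimit (diagAt I i M) :=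
  colimitObjIsoColimitCompEvaluation _ _

lemma ringMod_map (I : Ideal R) {s t : ℕᵒᵖ} (f : s ⟶ t) :
   (localCohomology.ringModIdeals (localCohomology.idealPowersDiagram I)).map f = 
    pr (Ideal.pow_le_pow_right f.unop.down.down : I ^ s.unop ≤ I ^ t.unop) := by
  refine ModuleCat.hom_ext (LinearMap.ext fun x => ?_)
  obtain ⟨x, rfl⟩ := Submodule.mkQ_surjective _ x
  change Submodule.Quotient.mk x = Submodule.Quotient.mk (1 * x)
  rw [one_mul]

lemma diagAt_map (I : Ideal R) (i : ℕ) (M : ModuleCat.{u} R) {s t : (ℕᵒᵖ)ᵒᵖ} (f : s ⟶ t) :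
   (diagAt I i M).map f = ((Ext R (ModuleCat.{u} R) i).map 
     (pr (Ideal.pow_le_pow_right f.unop.unop.down.down : I ^ t.unop.unop ≤ I ^ s.unop.unop)).op).app M := by
  rw [← ringMod_map]
  rfl

lemma subsingleton_iff_van (I : Ideal R) (i : ℕ) (M : ModuleCat.{u} R) :
    Subsingleton ((localCohomology I i).obj M) ↔ Van (fun n => I ^ n) i M := by
  have : PreservesFilteredColimitsOfSize.{0, 0} (forget (ModuleCat.{u} R)) :=
    preservesFilteredColimitsOfSize_shrink.{0, u, 0, u} _
  have : PreservesColimit (diagAt I i M) (forget (ModuleCat.{u} R)) :=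
    (PreservesFilteredColimitsOfSize.preserves_filtered_colimits (ℕᵒᵖ)ᵒᵖ).preservesColimit
  have e := (lcIso I i M).toLinearEquiv.toEquiv
  rw [e.subsingleton_congr]
  constructor
  · intro hs n x
    obtain ⟨a, ha⟩ := compare' M i x
    obtain ⟨j', f, hf⟩ := Concrete.colimit_rep_eq_zero R (diagAt I i M) (op (op n)) a (Subsingleton.elim _ _)
    rw [diagAt_map] at hf
    exact ⟨_, _, f.unop.unop.down.down, (ha _ _).1 hf⟩
  · intro hv
    refine subsingleton_of_forall_eq 0 fun x => ?_
    obtain ⟨j, a, rfl⟩ := Concrete.colimit_exists_rep _ x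
    obtain ⟨y, hy⟩ := compare M i a
    obtain ⟨m, h, hnm, hm⟩ := hv j.unop.unop y
    let f : j ⟶ op (op m) := (homOfLE hnm).op.op
    have := (hy _ _).2 hm
    have h2 : ((diagAt I i M).map f).hom a = 0 := by
      rw [diagAt_map]; exact this
    have h3 := congrArg (fun f => f.hom a) (colimit.w (diagAt I i M) f)
    refine h3.symm.trans ?_
    change (colimit.ι (diagAt I i M) (op (op m))).hom (((diagAt I i M).map f).hom a) = 0
    rw [h2, map_zero]

lemma Van.cofinal {b b' : ℕ → Ideal R} {i : ℕ} {L : ModuleCat.{u} R} (hv : Van b i L)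
    (h1 : ∀ n, ∃ m, b m ≤ b' n) (h2 : ∀ n n', ∃ m, n' ≤ m ∧ b' m ≤ b n) : Van b' i L := by
  intro n e
  obtain ⟨m, hm⟩ := h1 n
  obtain ⟨m₂, h, hmm, he⟩ := hv m (pb (pr hm) e)
  obtain ⟨k, hk, hk'⟩ := h2 m₂ n
  refine ⟨k, hk'.trans (h.trans hm), hk, ?_⟩
  rw [pb_comp, pr_comp] at he
  rw [← pr_comp hk' (h.trans hm), ← pb_comp, he, pb_zero]

lemma Van.middle {b : ℕ → Ideal R} {i : ℕ} {S : ShortComplex (ModuleCat.{u} R)}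
    (hS : S.ShortExact) (h₁ : Van b i S.X₁) (h₃ : Van b i S.X₃) : Van b i S.X₂ := by
  intro n e
  obtain ⟨m, h, hnm, hm⟩ := h₃ n (e.comp (Abelian.Ext.mk₀ S.g) (add_zero i))
  have : (pb (pr h) e).comp (Abelian.Ext.mk₀ S.g) (add_zero i) = 0 := by
    rw [← hm]; simp [pb]
  obtain ⟨x, hx⟩ := Abelian.Ext.covariant_sequence_exact₂ _ hS _ this
  obtain ⟨k, h', hmk, hk⟩ := h₁ m x
  refine ⟨k, h'.trans h, hnm.trans hmk, ?_⟩
  rw [← pr_comp h' h, ← pb_comp, ← hx]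
  have : pb (pr h') (x.comp (Abelian.Ext.mk₀ S.f) (add_zero i)) =
      (pb (pr h') x).comp (Abelian.Ext.mk₀ S.f) (add_zero i) := by simp [pb]
  rw [this, hk, Abelian.Ext.zero_comp]

lemma Van.right {b : ℕ → Ideal R} {i : ℕ} {S : ShortComplex (ModuleCat.{u} R)}
    (hS : S.ShortExact) (h₂ : Van b i S.X₂) (h₁ : Van b (i + 1) S.X₁) : Van b i S.X₃ := by
  intro n e
  obtain ⟨m, h, hnm, hm⟩ := h₁ n (e.comp hS.extClass rfl)
  have : (pb (pr h) e).comp hS.extClass rfl = 0 := by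
    rw [← hm]; exact Abelian.Ext.comp_assoc _ _ _ _ _ (by omega)
  obtain ⟨x, hx⟩ := Abelian.Ext.covariant_sequence_exact₃ _ hS _ _ this
  obtain ⟨k, h', hmk, hk⟩ := h₂ m x
  refine ⟨k, h'.trans h, hnm.trans hmk, ?_⟩
  rw [← pr_comp h' h, ← pb_comp, ← hx]
  have : pb (pr h') (x.comp (Abelian.Ext.mk₀ S.g) (add_zero i)) =
      (pb (pr h') x).comp (Abelian.Ext.mk₀ S.g) (add_zero i) := by simp [pb]
  rw [this, hk, Abelian.Ext.zero_comp]

lemma Van.of_iso {b : ℕ → Ideal R} {i : ℕ} {L L' : ModuleCat.{u} R} (f : L ≅ L')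
    (h : Van b i L) : Van b i L' := by
  intro n e
  obtain ⟨m, h, hnm, hm⟩ := h n (e.comp (Abelian.Ext.mk₀ f.inv) (add_zero i))
  refine ⟨m, h, hnm, ?_⟩
  have h2 : pb (pr h) e = ((pb (pr h) e).comp (Abelian.Ext.mk₀ f.inv) (add_zero i)).comp
      (Abelian.Ext.mk₀ f.hom) (add_zero i) := by simp
  have h3 : (pb (pr h) e).comp (Abelian.Ext.mk₀ f.inv) (add_zero i) = 0 := by
    rw [← hm]; simp [pb]
  rw [h2, h3, Abelian.Ext.zero_comp]

lemma Van.of_subsingleton (b : ℕ → Ideal R) (i : ℕ) (L : Type u) [AddCommGroup L] [Module R L]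
    [Subsingleton L] : Van b i (ModuleCat.of R L) := by
  intro n e
  refine ⟨n, le_rfl, le_rfl, ?_⟩
  have h : 𝟙 (ModuleCat.of R L) = 0 := by
    refine ModuleCat.hom_ext (LinearMap.ext fun x => Subsingleton.elim _ _)
  have : e = 0 := by
    rw [← Abelian.Ext.comp_mk₀_id e, h, Abelian.Ext.mk₀_zero, Abelian.Ext.comp_zero]
  rw [this, pb_zero]

/-- the colon ideal `(b n : x ^ n)` -/
def col (b : Ideal R) (r : R) : Ideal R := Submodule.comap (LinearMap.lsmul R R r) b

lemma mem_col {b : Ideal R} {r y : R} : y ∈ col b r ↔ r * y ∈ b := Iff.rfl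

lemma le_col (b : Ideal R) (r : R) : b ≤ col b r := fun _ hy => b.mul_mem_left _ hy

/-- `0 → R/(b : r) → R/b → R/(b + r) → 0` -/
noncomputable def ses (b : Ideal R) (r : R) : ShortComplex (ModuleCat.{u} R) :=
  ShortComplex.mk (mu (col b r) b r (fun _ h => h))
    (pr (le_sup_left : b ≤ b ⊔ Ideal.span {r})) (by
      refine ModuleCat.hom_ext (LinearMap.ext fun x => ?_)
      obtain ⟨x, rfl⟩ := Submodule.mkQ_surjective _ x
      change Submodule.Quotient.mk (1 * (r * x)) = 0
      rw [one_mul, Submodule.Quotient.mk_eq_zero]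
      exact Ideal.mul_mem_right _ _ (Ideal.mem_sup_right (Ideal.mem_span_singleton_self r)))

lemma ses_exact (b : Ideal R) (r : R) : (ses b r).ShortExact := by
  refine ModuleCat.shortComplex_shortExact _ ?_ ?_ ?_
  · intro y
    constructor
    · intro hy
      obtain ⟨y, rfl⟩ := Submodule.mkQ_surjective _ y
      change Submodule.Quotient.mk (1 * y) = 0 at hy
      rw [one_mul, Submodule.Quotient.mk_eq_zero] at hy
      obtain ⟨z, hz, w, hw, rfl⟩ := Submodule.mem_sup.1 hy
      obtain ⟨w, rfl⟩ := Ideal.mem_span_singleton'.1 hw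
      refine ⟨Submodule.Quotient.mk w, ?_⟩
      change Submodule.Quotient.mk (r * w) = Submodule.Quotient.mk _
      rw [Submodule.Quotient.eq]
      have : r * w - (z + w * r) = - z := by ring
      rw [this]; exact neg_mem hz
    · rintro ⟨y, rfl⟩
      exact LinearMap.congr_fun (congrArg ModuleCat.Hom.hom (ses b r).zero) y
  · intro y z hyz
    obtain ⟨y, rfl⟩ := Submodule.mkQ_surjective _ y
    obtain ⟨z, rfl⟩ := Submodule.mkQ_surjective _ z
    change Submodule.Quotient.mk (r * y) = Submodule.Quotient.mk (r * z) at hyz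
    rw [Submodule.Quotient.eq] at hyz
    change Submodule.Quotient.mk y = Submodule.Quotient.mk z
    rw [Submodule.Quotient.eq, mem_col, mul_sub]
    exact hyz
  · intro y
    obtain ⟨y, rfl⟩ := Submodule.mkQ_surjective _ y
    refine ⟨Submodule.Quotient.mk y, ?_⟩
    change Submodule.Quotient.mk (1 * y) = Submodule.Quotient.mk y
    rw [one_mul]

lemma col_stable [IsNoetherianRing R] (b : Ideal R) (x : R) :
    ∃ N, ∀ l y, x ^ l * y ∈ b → x ^ N * y ∈ b := by
  let f : ℕ →o Ideal R := ⟨fun n => col b (x ^ n), fun n m h y hy => by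
    rw [mem_col] at hy ⊢
    obtain ⟨k, rfl⟩ := Nat.exists_eq_add_of_le h
    rw [pow_add, mul_comm (x ^ n), mul_assoc]
    exact b.mul_mem_left _ hy⟩
  obtain ⟨N, hN⟩ := monotone_stabilizes_iff_noetherian.2 (inferInstance : IsNoetherian R R) f
  refine ⟨N, fun l y hy => ?_⟩
  have h1 : y ∈ f (max N l) := f.monotone (le_max_right N l) hy
  rw [← hN _ (le_max_left N l)] at h1
  exact h1

lemma sup_le_aux {b : ℕ → Ideal R} (hb : ∀ m l, m ≤ l → b l ≤ b m) (x : R) {m l : ℕ} (h : m ≤ l) :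
    b l ⊔ Ideal.span {x ^ l} ≤ b m ⊔ Ideal.span {x ^ m} := by
  refine sup_le_sup (hb _ _ h) ?_
  rw [Ideal.span_singleton_le_span_singleton]
  exact pow_dvd_pow _ h

/-- transition maps of the short exact sequences -/
noncomputable def sesMap {b : ℕ → Ideal R} (hb : ∀ m l, m ≤ l → b l ≤ b m) (x : R) {m l : ℕ} (h : m ≤ l) :
    ses (b l) (x ^ l) ⟶ ses (b m) (x ^ m) where
  τ₁ := mu _ _ (x ^ (l - m)) (fun y hy => by
    rw [mem_col] at hy ⊢
    rw [← mul_assoc, ← pow_add, Nat.add_sub_cancel' h]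
    exact hb _ _ h hy)
  τ₂ := pr (hb _ _ h)
  τ₃ := pr (sup_le_aux hb x h)
  comm₁₂ := by
    dsimp only [ses]
    refine (mu_comp _ _).trans (Eq.trans ?_ (mu_comp _ _).symm)
    exact mu_congr (by rw [← pow_add, Nat.add_sub_cancel' h, one_mul]) _
  comm₂₃ := by
    dsimp only [ses]
    rw [pr_comp, pr_comp]

lemma Van.step [IsNoetherianRing R] {b : ℕ → Ideal R} (hb : ∀ m l, m ≤ l → b l ≤ b m) (x : R)
    {i : ℕ} {L : ModuleCat.{u} R} (h0 : Van b i L) (h1 : Van b (i + 1) L) :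
    Van (fun n => b n ⊔ Ideal.span {x ^ n}) (i + 1) L := by
  intro n e
  obtain ⟨m, hmb, hnm, hm⟩ := h1 n (pb (pr le_sup_left) e)
  have hcm := sup_le_aux hb x hnm
  have : pb (ses (b m) (x ^ m)).g (pb (pr hcm) e) = 0 := by
    rw [pb_comp, pr_comp] at hm
    dsimp only [ses]
    rw [pb_comp, pr_comp]
    exact hm
  obtain ⟨f, hf⟩ := Abelian.Ext.contravariant_sequence_exact₃ (ses_exact (b m) (x ^ m)) _ _ this
    (add_comm 1 i)
  obtain ⟨k, hkb, hmk, hk⟩ := h0 m (pb (pr (le_col (b m) (x ^ m))) f)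
  obtain ⟨N, hN⟩ := col_stable (b k) x
  let l := k + m + N
  have hml : m ≤ l := by omega
  have hkl : k ≤ l := by omega
  refine ⟨l, sup_le_aux hb x (hnm.trans hml), hnm.trans hml, ?_⟩
  have hfac : (sesMap hb x hml).τ₁ = mu (col (b l) (x ^ l)) (b k) (x ^ (l - m)) (fun y hy => by
      have h3 := hN l y (hb _ _ hkl (mem_col.1 hy))
      have : l - m = k + N := by omega
      rw [this, pow_add, mul_assoc]
      exact Ideal.mul_mem_left _ _ h3) ≫ pr hkb ≫ pr (le_col (b m) (x ^ m)) := by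
    rw [pr_comp, mu_comp]
    exact mu_congr (one_mul _).symm _
  have hz : pb (sesMap hb x hml).τ₁ f = 0 := by
    rw [hfac]
    refine (pb_comp _ _ _).symm.trans ?_
    have hz' := (pb_comp (pr hkb) (pr (le_col (b m) (x ^ m))) f).symm.trans hk
    exact (congrArg (pb _) hz').trans (pb_zero _)
  rw [← pr_comp (sup_le_aux hb x hml) hcm, ← pb_comp, ← hf]
  have nat := ShortComplex.ShortExact.extClass_naturality (ses_exact (b l) (x ^ l))
    (ses_exact (b m) (x ^ m)) (sesMap hb x hml)
  change (Abelian.Ext.mk₀ (sesMap hb x hml).τ₃).comp _ _ = 0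
  rw [← Abelian.Ext.comp_assoc _ _ _ (zero_add 1) _ (by omega), ← nat,
    Abelian.Ext.comp_assoc _ _ _ _ (zero_add i) (by omega)]
  change (ses_exact (b l) (x ^ l)).extClass.comp (pb (sesMap hb x hml).τ₁ f) _ = 0
  rw [hz, Abelian.Ext.comp_zero]

lemma van_bound [IsNoetherianRing R] (I : Ideal R) :
    ∃ d, ∀ i, d ≤ i → ∀ L : ModuleCat.{u} R, Van (fun n => I ^ n) i L := by
  have main : ∀ J : Ideal R, 
      (∃ d, ∀ i, d ≤ i → ∀ L : ModuleCat.{u} R, Van (fun n => J ^ n) i L) →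
      ∃ d, ∀ i, d ≤ i → ∀ L : ModuleCat.{u} R, Van (fun n => (J ⊔ I) ^ n) i L := by
    have hfg : I.FG := IsNoetherian.noetherian I
    induction I, hfg using Submodule.fg_induction with
    | singleton x =>
      rintro J ⟨d, hd⟩
      refine ⟨d + 1, fun i hi L => ?_⟩
      obtain ⟨i, rfl⟩ : ∃ j, i = j + 1 := ⟨i - 1, by omega⟩
      refine (Van.step (b := fun n => J ^ n) (fun _ _ h => Ideal.pow_le_pow_right h) x
        (hd i (by omega) L) (hd (i + 1) (by omega) L)).cofinal ?_ ?_
      · intro n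
        refine ⟨n, sup_le (Ideal.pow_right_mono le_sup_left n) ?_⟩
        rw [← Ideal.span_singleton_pow]
        exact Ideal.pow_right_mono le_sup_right n
      · intro n n'
        refine ⟨n + n + n', by omega, (Ideal.pow_le_pow_right (Nat.le_add_right _ _)).trans ?_⟩
        rw [← Ideal.span_singleton_pow]
        exact Ideal.sup_pow_add_le_pow_sup_pow
    | sup I₁ I₂ _ _ h₁ h₂ =>
      intro J hJ
      have := h₂ _ (h₁ J hJ)
      simpa [sup_assoc] using this
  have h0 := main ⊥ ?_
  · simpa using h0
  · refine ⟨1, fun i hi L => ?_⟩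
    intro n e
    have hle : (⊥ : Ideal R) ^ (n + 1) ≤ ⊥ ^ n := Ideal.pow_le_pow_right (Nat.le_succ n)
    refine ⟨n + 1, hle, Nat.le_succ n, ?_⟩
    have hbot : (⊥ : Ideal R) ^ (n + 1) = ⊥ := by
      rw [pow_succ, Ideal.mul_bot]
    have : Module.Projective R (R ⧸ (⊥ : Ideal R) ^ (n + 1)) :=
      Module.Projective.of_equiv (Submodule.quotEquivOfEqBot _ hbot).symm
    have : Projective (ModuleCat.of R (R ⧸ (⊥ : Ideal R) ^ (n + 1))) :=
      (IsProjective.iff_projective _).1 this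
    obtain ⟨i, rfl⟩ : ∃ j, i = j + 1 := ⟨i - 1, by omega⟩
    exact Abelian.Ext.eq_zero_of_projective _

section Descent

variable {b : ℕ → Ideal R} {i : ℕ} {A B C : Type u} [AddCommGroup A] [Module R A]
  [AddCommGroup B] [Module R B] [AddCommGroup C] [Module R C]

lemma Van.middle_lin (f : A →ₗ[R] B) (g : B →ₗ[R] C)
    (hf : Function.Injective f) (hg : Function.Surjective g) (h : Function.Exact f g)
    (h₁ : Van b i (ModuleCat.of R A)) (h₃ : Van b i (ModuleCat.of R C)) :
    Van b i (ModuleCat.of R B) := by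
  have hS := ModuleCat.shortComplex_shortExact
    (ShortComplex.mk (ModuleCat.ofHom f) (ModuleCat.ofHom g)
    (ModuleCat.hom_ext h.linearMap_comp_eq_zero)) h hf hg
  exact Van.middle hS h₁ h₃

lemma Van.right_lin (f : A →ₗ[R] B) (g : B →ₗ[R] C)
    (hf : Function.Injective f) (hg : Function.Surjective g) (h : Function.Exact f g)
    (h₂ : Van b i (ModuleCat.of R B)) (h₁ : Van b (i + 1) (ModuleCat.of R A)) :
    Van b i (ModuleCat.of R C) := by
  have hS := ModuleCat.shortComplex_shortExact
    (ShortComplex.mk (ModuleCat.ofHom f) (ModuleCat.ofHom g)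
    (ModuleCat.hom_ext h.linearMap_comp_eq_zero)) h hf hg
  exact Van.right hS h₂ h₁

end Descent

lemma exists_hom_ne_zero [IsNoetherianRing R] (M : Type u) [AddCommGroup M] [Module R M]
    [Module.Finite R M] (p : PrimeSpectrum R) (hp : p ∈ Module.support R M) :
    ∃ f : M →ₗ[R] (R ⧸ p.1), f ≠ 0 := by
  by_contra hcon
  push Not at hcon
  have hs : Subsingleton (M →ₗ[R] (R ⧸ p.1)) := subsingleton_of_forall_eq 0 hcon
  obtain ⟨r, hr, hreg⟩ := IsSMulRegular.subsingleton_linearMap_iff.1 hs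
  have hrp : r ∈ p.1 := Module.annihilator_le_of_mem_support hp hr
  have h1 : (Ideal.Quotient.mk p.1 1) = 0 := by
    apply hreg
    beta_reduce
    rw [smul_zero, ← Ideal.Quotient.mk_eq_mk, ← Submodule.Quotient.mk_smul,
      Submodule.Quotient.mk_eq_zero]
    simpa using hrp
  rw [Ideal.Quotient.eq_zero_iff_mem] at h1
  exact p.2.ne_top ((Ideal.eq_top_iff_one _).2 h1)

lemma descent_step [IsNoetherianRing R] (b : ℕ → Ideal R) (i : ℕ)
    (M : Type u) [AddCommGroup M] [Module R M] [Module.Finite R M]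
    (hM : Van b i (ModuleCat.of R M))
    (hQ : ∀ (N : Type u) [AddCommGroup N] [Module R N] [Module.Finite R N],
      Module.support R N ⊆ Module.support R M → Van b (i + 1) (ModuleCat.of R N))
    (J : Ideal R) : ∀ (N : Type u) [AddCommGroup N] [Module R N] [Module.Finite R N],
      J ≤ Module.annihilator R N →
      Module.support R N ⊆ Module.support R M → Van b i (ModuleCat.of R N) := by
  induction J using WellFoundedGT.induction with
  | ind J ih =>
  intro N _ _ hfin
  refine IsNoetherianRing.induction_on_isQuotientEquivQuotientPrime R hfin
    (motive := fun N _ _ _ => J ≤ Module.annihilator R N →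
      Module.support R N ⊆ Module.support R M → Van b i (ModuleCat.of R N)) ?_ ?_ ?_
  · intro N _ _ _ _ _ _
    exact Van.of_subsingleton _ _ _
  · intro N _ _ _ p e hJ hsupp
    refine Van.of_iso e.symm.toModuleIso ?_
    rw [e.annihilator_eq, Ideal.annihilator_quotient] at hJ
    rw [e.support_eq] at hsupp
    rcases hJ.lt_or_eq with hlt | rfl
    · exact ih _ hlt (R ⧸ p.1) (Ideal.annihilator_quotient).ge hsupp
    · have hp : p ∈ Module.support R M := hsupp (by
        rw [Module.mem_support_iff_of_finite, Ideal.annihilator_quotient])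
      obtain ⟨f, hf⟩ := exists_hom_ne_zero M p hp
      have hK : Van b i (ModuleCat.of R (LinearMap.range f)) := by
        refine Van.right_lin (LinearMap.ker f).subtype f.rangeRestrict
          (Submodule.subtype_injective _) f.surjective_rangeRestrict ?_ hM (hQ _ ?_)
        · rw [LinearMap.exact_iff, LinearMap.ker_rangeRestrict, Submodule.range_subtype]
        · exact Module.support_subset_of_injective _ (Submodule.subtype_injective _)
      refine Van.middle_lin (LinearMap.range f).subtype (LinearMap.range f).mkQ
        (Submodule.subtype_injective _) (Submodule.mkQ_surjective _)
        (LinearMap.exact_subtype_mkQ _) hK ?_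
      obtain ⟨y, hy⟩ : ∃ y, f y ≠ 0 := by
        by_contra hcon
        push Not at hcon
        exact hf (LinearMap.ext hcon)
      obtain ⟨r, hr⟩ := Submodule.mkQ_surjective _ (f y)
      have hrp : r ∉ p.1 := by
        intro h
        exact hy (hr.symm.trans ((Submodule.Quotient.mk_eq_zero _).2 h))
      refine ih (p.1 ⊔ Ideal.span {r}) ?_ _ ?_ ?_
      · refine lt_of_le_of_ne le_sup_left fun h => hrp ?_
        rw [h]
        exact Ideal.mem_sup_right (Ideal.mem_span_singleton_self r)
      · refine sup_le ?_ ?_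
        · refine le_trans (Ideal.annihilator_quotient (I := p.1)).ge ?_
          exact LinearMap.annihilator_le_of_surjective _ (Submodule.mkQ_surjective _)
        · rw [Ideal.span_singleton_le_iff_mem, Module.mem_annihilator]
          intro z
          obtain ⟨z, rfl⟩ := Submodule.mkQ_surjective _ z
          obtain ⟨z, rfl⟩ := Submodule.mkQ_surjective _ z
          rw [← map_smul, ← map_smul, Submodule.mkQ_apply, Submodule.Quotient.mk_eq_zero,
            smul_eq_mul, mul_comm, ← smul_eq_mul, map_smul, hr]
          exact Submodule.smul_mem _ _ (LinearMap.mem_range_self f y)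
      · exact (Module.support_subset_of_surjective _ (Submodule.mkQ_surjective _)).trans hsupp
  · intro N₁ _ _ _ N₂ _ _ _ N₃ _ _ _ f g hf hg hfg h₁ h₃ hJ hsupp
    exact Van.middle_lin f g hf hg hfg
      (h₁ (hJ.trans (LinearMap.annihilator_le_of_injective f hf))
        ((Module.support_subset_of_injective f hf).trans hsupp))
      (h₃ (hJ.trans (LinearMap.annihilator_le_of_surjective g hg))
        ((Module.support_subset_of_surjective g hg).trans hsupp))

lemma descent [IsNoetherianRing R] (b : ℕ → Ideal R) (c d : ℕ)
    (hd : ∀ i, d ≤ i → ∀ L : ModuleCat.{u} R, Van b i L)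
    (M : Type u) [AddCommGroup M] [Module R M] [Module.Finite R M]
    (hM : ∀ j, c ≤ j → Van b j (ModuleCat.of R M)) (k : ℕ) :
    ∀ i, c ≤ i → d ≤ i + k → ∀ (N : Type u) [AddCommGroup N] [Module R N] [Module.Finite R N],
      Module.support R N ⊆ Module.support R M → Van b i (ModuleCat.of R N) := by
  induction k with
  | zero => exact fun i _ hi N _ _ _ _ => hd i hi _
  | succ k ih =>
    intro i hci hdi N _ _ _ hs
    exact descent_step b i M (hM i hci)
      (fun N _ _ _ hs => ih (i + 1) (by omega) (by omega) N hs) ⊥ N bot_le hs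

end LCAux

/-- If `R` is Noetherian and `M`, `N` are finitely generated with `Supp N ⊆ Supp M`,
then `cd(𝔞, N) ≤ cd(𝔞, M)`. -/
theorem stmt_0 {R : Type u} [CommRing R] [IsNoetherianRing R] (𝔞 : Ideal R)
    (M N : Type u) [AddCommGroup M] [Module R M] [AddCommGroup N] [Module R N]
    [Module.Finite R M] [Module.Finite R N]
    (h : Module.support R N ⊆ Module.support R M) :
    cohDim 𝔞 N ≤ cohDim 𝔞 M := by
  unfold cohDim
  refine sSup_le ?_
  rintro n ⟨i, rfl, hi⟩
  by_contra hlt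
  have hM : ∀ j, i ≤ j → LCAux.Van (fun n => 𝔞 ^ n) j (ModuleCat.of R M) := by
    intro j hij
    rw [← LCAux.subsingleton_iff_van, ← not_nontrivial_iff_subsingleton]
    intro hj
    refine hlt (le_trans ?_ (le_sSup ⟨j, rfl, hj⟩))
    exact_mod_cast hij
  obtain ⟨d, hd⟩ := LCAux.van_bound 𝔞
  have hN := LCAux.descent _ i d hd M hM d i le_rfl (by omega) N h
  rw [← LCAux.subsingleton_iff_van] at hN
  exact not_nontrivial_iff_subsingleton.2 hN hi
end

section
/- Let R be Noetherian, 𝔞 an ideal, M a nonzero finitely generated R-module with c = cd(𝔞, M) finite, and let 0 = ∩_{j=1}^n N_j be a reduced primary decomposition of 0 in M with N_j being 𝔭_j-primary. For 0 ≤ i ≤ c, set 𝔞_i = ∏_{cd(𝔞, R/𝔭_j) ≤ i} 𝔭_j. Then the largest submodule M_i of M with cd(𝔞, M_i) ≤ i equals H^0_{𝔞_i}(M) and equals ∩_{cd(𝔞, R/𝔭_j) > i} N_j. -/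
open CategoryTheory

universe u

/-- A submodule `N ≤ M` is `p`-primary if `Ass_R (M ⧸ N) = {p}`. -/
def IsPrimarySubmodule {R : Type u} [CommRing R] {M : Type u} [AddCommGroup M] [Module R M]
    (N : Submodule R M) (p : Ideal R) : Prop :=
  associatedPrimes R (M ⧸ N) = {p}


namespace LC
open Limits Opposite
section
variable {R : Type u} [CommRing R]

/-- the class in homology represented by a cocycle -/
def Cls (K : ChainComplex (ModuleCat.{u} R)ᵒᵖ ℕ) (n : ℕ) (z : (K.X n).unop)
    (h : (K.homology n).unop) : Prop :=
  ∃ w : (K.opcycles n).unop, (K.pOpcycles n).unop.hom w = z ∧ (K.homologyι n).unop.hom w = h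

lemma Cls.exists_rep (K : ChainComplex (ModuleCat.{u} R)ᵒᵖ ℕ) (n : ℕ) 
    (h : (K.homology n).unop) : ∃ z, Cls K n z h ∧ (K.d (n+1) n).unop.hom z = 0 := by
  have : Function.Surjective (K.homologyι n).unop.hom :=
    (ModuleCat.epi_iff_surjective _).1 inferInstance
  obtain ⟨w, hw⟩ := this h
  refine ⟨_, ⟨w, rfl, hw⟩, ?_⟩
  have := congrArg (fun f => f.unop.hom w) (K.d_pOpcycles (n+1) n)
  exact this

lemma Cls.exists_class (K : ChainComplex (ModuleCat.{u} R)ᵒᵖ ℕ) (n : ℕ) 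
    (z : (K.X n).unop) (hz : (K.d (n+1) n).unop.hom z = 0) : ∃ h, Cls K n z h := by
  have ex := ShortComplex.exact_of_g_is_cokernel
    (.mk _ _ (K.d_pOpcycles (n+1) n)) (K.opcyclesIsCokernel (n+1) n (by simp))
  have ex' := (ShortComplex.moduleCat_exact_iff _).1 ex.unop
  obtain ⟨w, hw⟩ := ex' z hz
  exact ⟨_, w, hw, rfl⟩

lemma Cls.eq_zero_iff (K : ChainComplex (ModuleCat.{u} R)ᵒᵖ ℕ) (n : ℕ) 
    (z : (K.X (n+1)).unop) (h) (hz : Cls K (n+1) z h) : h = 0 ↔ 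
      ∃ y : (K.X n).unop, (K.d (n+1) n).unop.hom y = z := by
  have ex := ShortComplex.exact_of_f_is_kernel
    (.mk _ _ (K.homologyι_comp_fromOpcycles (n+1) n)) (K.homologyIsKernel (n+1) n (by simp))
  have ex' := (ShortComplex.moduleCat_exact_iff _).1 ex.unop
  obtain ⟨w, hw, hh⟩ := hz
  have pf : ∀ y, (K.pOpcycles (n+1)).unop.hom ((K.fromOpcycles (n+1) n).unop.hom y) = 
    (K.d (n+1) n).unop.hom y := fun y =>
      congrArg (fun f => f.unop.hom y) (K.p_fromOpcycles (n+1) n)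
  constructor
  · rintro rfl
    obtain ⟨y, hy⟩ := ex' w hh
    exact ⟨y, (pf y).symm.trans ((congrArg _ hy).trans hw)⟩
  · rintro ⟨y, hy⟩
    have inj : Function.Injective (K.pOpcycles (n+1)).unop.hom :=
      (ModuleCat.mono_iff_injective _).1 inferInstance
    have : w = (K.fromOpcycles (n+1) n).unop.hom y := inj (by rw [pf, hy, hw])
    rw [← hh, this]
    exact congrArg (fun f => f.unop.hom y) (K.homologyι_comp_fromOpcycles (n+1) n)

lemma Cls.map {K L : ChainComplex (ModuleCat.{u} R)ᵒᵖ ℕ} (φ : K ⟶ L) (n : ℕ) 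
    (z : (L.X n).unop) (h) (hz : Cls L n z h) :
    Cls K n ((φ.f n).unop.hom z) ((HomologicalComplex.homologyMap φ n).unop.hom h) := by
  obtain ⟨w, rfl, rfl⟩ := hz
  refine ⟨(HomologicalComplex.opcyclesMap φ n).unop.hom w, ?_, ?_⟩
  · exact congrArg (fun f => f.unop.hom w) (HomologicalComplex.p_opcyclesMap φ n)
  · exact (congrArg (fun f => f.unop.hom w) (HomologicalComplex.homologyι_naturality φ n)).symm

/-- matching of elements in the two versions of `Ext`. -/
def Match {A Y : ModuleCat.{u} R} {n : ℕ} (x : ((Ext R (ModuleCat.{u} R) n).obj (op A)).obj Y)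
    (α : Abelian.Ext A Y n) : Prop :=
  ∀ (A' : ModuleCat.{u} R) (g : A' ⟶ A),
    (((Ext R (ModuleCat.{u} R) n).map g.op).app Y).hom x = 0 ↔
      (Abelian.Ext.mk₀ g).comp α (zero_add n) = 0

abbrev FF (Y : ModuleCat.{u} R) := (((linearYoneda R (ModuleCat.{u} R)).obj Y).rightOp)

lemma match_of_rep {A Y : ModuleCat.{u} R} {n : ℕ} (P : ProjectiveResolution A)
    (x : ((Ext R (ModuleCat.{u} R) (n+1)).obj (op A)).obj Y)
    (f : P.complex.X (n+1) ⟶ Y) (hf : P.complex.d (n+2) (n+1) ≫ f = 0)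
    (h : Cls (((FF Y).mapHomologicalComplex _).obj P.complex) (n+1) f
      ((P.isoLeftDerivedObj (FF Y) (n+1)).inv.unop.hom x)) :
    Match x (P.extMk f (n+2) rfl hf) := by
  intro A' g
  let P' := projectiveResolution A'
  let φ := ProjectiveResolution.lift g P' P
  have comm : φ.f 0 ≫ P.π.f 0 = P'.π.f 0 ≫ g :=
    HomologicalComplex.congr_hom (ProjectiveResolution.lift_commutes g P' P) 0
  have nat := P'.isoLeftDerivedObj_hom_naturality g P φ comm (FF Y) (n+1)
  rw [ProjectiveResolution.mk₀_comp_extMk (R' := P') f _ _ _ ⟨φ, by simpa using comm⟩,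
    ProjectiveResolution.extMk_eq_zero_iff _ _ _ _ _ n rfl]
  have h2 := Cls.map (((FF Y).mapHomologicalComplex _).map φ) _ _ _ h
  have h3 := Cls.eq_zero_iff _ _ _ _ h2
  refine Iff.trans ?_ h3
  have e : (P.isoLeftDerivedObj (FF Y) (n+1)).hom.unop.hom 
     ((P.isoLeftDerivedObj (FF Y) (n+1)).inv.unop.hom x) = x := 
      congrArg (fun f => f.unop.hom x) (P.isoLeftDerivedObj (FF Y) (n+1)).hom_inv_id
  set x' := (P.isoLeftDerivedObj (FF Y) (n+1)).inv.unop.hom x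
  have key : (((Ext R (ModuleCat.{u} R) (n+1)).map g.op).app Y).hom x = 
      (P'.isoLeftDerivedObj (FF Y) (n+1)).hom.unop.hom 
        ((HomologicalComplex.homologyMap (((FF Y).mapHomologicalComplex _).map φ) (n+1)).unop.hom x') := by
    rw [← e]
    exact (congrArg (fun f => f.unop.hom x') nat)
  rw [key]
  have inj : Function.Injective (P'.isoLeftDerivedObj (FF Y) (n+1)).hom.unop.hom :=
      (ModuleCat.mono_iff_injective _).1 inferInstance
  constructor
  · intro h; apply inj; rw [h]; exact (map_zero _).symm
  · intro h; rw [h]; exact (map_zero _)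

lemma exists_match_right {A Y : ModuleCat.{u} R} {n : ℕ}
    (x : ((Ext R (ModuleCat.{u} R) (n+1)).obj (op A)).obj Y) : 
    ∃ α : Abelian.Ext A Y (n+1), Match x α := by
  let P := projectiveResolution A
  obtain ⟨f, h1, h2⟩ := Cls.exists_rep (((FF Y).mapHomologicalComplex _).obj P.complex) (n+1) 
    ((P.isoLeftDerivedObj (FF Y) (n+1)).inv.unop.hom x)
  exact ⟨_, match_of_rep P x f h2 h1⟩

lemma exists_match_left {A Y : ModuleCat.{u} R} {n : ℕ} (α : Abelian.Ext A Y (n+1)) :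
    ∃ x : ((Ext R (ModuleCat.{u} R) (n+1)).obj (op A)).obj Y, Match x α := by
  let P := projectiveResolution A
  obtain ⟨f, hf, rfl⟩ := P.extMk_surjective α (n+2) rfl
  obtain ⟨h, hh⟩ := Cls.exists_class (((FF Y).mapHomologicalComplex _).obj P.complex) (n+1) f hf
  refine ⟨(P.isoLeftDerivedObj (FF Y) (n+1)).hom.unop.hom h, match_of_rep P _ f hf ?_⟩
  have e : (P.isoLeftDerivedObj (FF Y) (n+1)).inv.unop.hom 
     ((P.isoLeftDerivedObj (FF Y) (n+1)).hom.unop.hom h) = h := 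
      congrArg (fun f => f.unop.hom h) (P.isoLeftDerivedObj (FF Y) (n+1)).inv_hom_id
  rw [e]
  exact hh

/-- the transition map -/
abbrev tr {I J : Ideal R} (h : I ≤ J) : ModuleCat.of R (R ⧸ I) ⟶ ModuleCat.of R (R ⧸ J) :=
  ModuleCat.ofHom (Submodule.mapQ I J LinearMap.id h)

def Van (I : Ideal R) (j : ℕ) (Y : ModuleCat.{u} R) : Prop :=
  ∀ t (α : Abelian.Ext (ModuleCat.of R (R ⧸ I ^ t)) Y j), ∃ s, ∃ h : t ≤ s,
    (Abelian.Ext.mk₀ (tr (Ideal.pow_le_pow_right h))).comp α (zero_add j) = 0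

lemma van_iff (I : Ideal R) (j : ℕ) (Y : ModuleCat.{u} R) :
    Subsingleton ((localCohomology I (j+1)).obj Y) ↔ Van I (j+1) Y := by
  let D := localCohomology.diagram (localCohomology.idealPowersDiagram I) (j+1)
  let hD := isColimitOfPreserves ((evaluation (ModuleCat.{u} R) (ModuleCat.{u} R)).obj Y)
    (colimit.isColimit D)
  have i1 : PreservesColimitsOfShape (ℕᵒᵖᵒᵖ) (forget (ModuleCat.{u} R)) :=
    (preservesFilteredColimitsOfSize_of_univLE.{u, u, 0, 0}
      (forget (ModuleCat.{u} R))).preserves_filtered_colimits _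
  have i2 : PreservesColimit (D ⋙ (evaluation (ModuleCat.{u} R) (ModuleCat.{u} R)).obj Y)
    (forget (ModuleCat.{u} R)) := i1.preservesColimit
  constructor
  · intro hs t α
    obtain ⟨x, hx⟩ := exists_match_left α
    obtain ⟨k, f, g, e⟩ := Concrete.isColimit_exists_of_rep_eq (i := op (op t)) (j := op (op t)) _ hD x
      (0 : ((Ext R (ModuleCat.{u} R) (j+1)).obj (op _)).obj Y)
      (Subsingleton.elim (α := ((localCohomology I (j+1)).obj Y)) _ _)
    refine ⟨k.unop.unop, leOfHom f.unop.unop, ?_⟩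
    rw [← hx]
    exact e.trans (map_zero (((D ⋙ (evaluation (ModuleCat.{u} R) (ModuleCat.{u} R)).obj Y).map g).hom))
  · intro hv
    suffices ∀ x : ((localCohomology I (j+1)).obj Y), x = 0 from ⟨fun a b => (this a).trans (this b).symm⟩
    intro x
    obtain ⟨t, y, rfl⟩ := Concrete.isColimit_exists_rep _ hD x
    obtain ⟨α, hα⟩ := exists_match_right (n := j) (A := ModuleCat.of R (R ⧸ I ^ t.unop.unop)) (Y := Y) y
    obtain ⟨s, hs, h0⟩ := hv _ α
    rw [← hα] at h0
    have w := (((evaluation (ModuleCat.{u} R) (ModuleCat.{u} R)).obj Y).mapCocone (colimit.cocone D)).w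
      (show t ⟶ op (op s) from (homOfLE hs).op.op)
    rw [← w]
    refine (congrArg _ h0).trans (map_zero (((colimit.ι D (op (op s))).app Y).hom))
end
end LC


namespace LC
open Limits Opposite
open Abelian (Ext)
open Abelian.Ext (mk₀)
section
variable {R : Type u} [CommRing R]

/-- multiplication by `c` as a map `R/A → R/B`. -/
abbrev mu (c : R) (A B : Ideal R) (h : ∀ a ∈ A, c * a ∈ B) :
    ModuleCat.of R (R ⧸ A) ⟶ ModuleCat.of R (R ⧸ B) :=
  ModuleCat.ofHom (Submodule.mapQ A B (LinearMap.mulLeft R c) h)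

lemma tr_eq_mu {I J : Ideal R} (h : I ≤ J) : tr h = mu 1 I J (fun a ha => by simpa using h ha) := by
  ext; simp [tr, mu]

lemma mu_comp (c d : R) (A B C : Ideal R) (h h') :
    mu c A B h ≫ mu d B C h' = mu (c * d) A C (fun a ha => by
      rw [mul_comm c d, mul_assoc]; exact h' _ (h _ ha)) := by
  ext
  refine (Submodule.Quotient.eq C).2 ?_
  simp [mul_comm c d]

lemma mu_congr {c d : R} (e : c = d) (A B : Ideal R) (h h') : mu c A B h = mu d A B h' := by
  subst e; rfl

lemma tr_comp {I J K : Ideal R} (h : I ≤ J) (h' : J ≤ K) :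
    tr h ≫ tr h' = tr (h.trans h') := by
  ext; simp [tr]

lemma van_mid (I : Ideal R) (j : ℕ) {S : ShortComplex (ModuleCat.{u} R)} (hS : S.ShortExact)
    (h1 : Van I j S.X₁) (h3 : Van I j S.X₃) : Van I j S.X₂ := by
  intro t α
  obtain ⟨s, hs, e⟩ := h3 t (α.comp (mk₀ S.g) (add_zero _))
  rw [← Abelian.Ext.comp_assoc _ _ _ (zero_add _) (add_zero _) (by lia)] at e
  obtain ⟨β, hβ⟩ := Abelian.Ext.covariant_sequence_exact₂ _ hS _ e
  obtain ⟨r, hr, e'⟩ := h1 s β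
  refine ⟨r, hs.trans hr, ?_⟩
  rw [← tr_comp (Ideal.pow_le_pow_right hr) (Ideal.pow_le_pow_right hs),
    ← Abelian.Ext.mk₀_comp_mk₀_assoc, ← hβ,
    ← Abelian.Ext.comp_assoc _ _ _ (zero_add _) (add_zero _) (by lia), e', Abelian.Ext.zero_comp]

lemma van_right (I : Ideal R) (j : ℕ) {S : ShortComplex (ModuleCat.{u} R)} (hS : S.ShortExact)
    (h1 : Van I (j + 1) S.X₁) (h2 : Van I j S.X₂) : Van I j S.X₃ := by
  intro t α
  obtain ⟨s, hs, e⟩ := h1 t (α.comp hS.extClass rfl)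
  rw [← Abelian.Ext.comp_assoc _ _ _ (zero_add _) rfl (by lia)] at e
  obtain ⟨β, hβ⟩ := Abelian.Ext.covariant_sequence_exact₃ _ hS _ _ e
  obtain ⟨r, hr, e'⟩ := h2 s β
  refine ⟨r, hs.trans hr, ?_⟩
  rw [← tr_comp (Ideal.pow_le_pow_right hr) (Ideal.pow_le_pow_right hs),
    ← Abelian.Ext.mk₀_comp_mk₀_assoc, ← hβ,
    ← Abelian.Ext.comp_assoc _ _ _ (zero_add _) (add_zero _) (by lia), e', Abelian.Ext.zero_comp]

/-- `f` induces zero on all `Ext` groups of degree greater than `d` -/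
def Kill {A B : ModuleCat.{u} R} (f : A ⟶ B) (d : ℕ) : Prop :=
  ∀ (i : ℕ) (_ : d < i) (Y : ModuleCat.{u} R) (α : Ext B Y i), (mk₀ f).comp α (zero_add i) = 0

lemma Kill.comp_left {A B C : ModuleCat.{u} R} (g : A ⟶ B) {f : B ⟶ C} {d : ℕ} (h : Kill f d) :
    Kill (g ≫ f) d := by
  intro i hi Y α
  rw [← Abelian.Ext.mk₀_comp_mk₀_assoc, h i hi, Abelian.Ext.comp_zero]

lemma Kill.comp_right {A B C : ModuleCat.{u} R} {g : A ⟶ B} {d : ℕ} (h : Kill g d) (f : B ⟶ C) :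
    Kill (g ≫ f) d := by
  intro i hi Y α
  rw [← Abelian.Ext.mk₀_comp_mk₀_assoc, h i hi]

/-- `J : x` -/
def col (J : Ideal R) (x : R) : Ideal R := Submodule.comap (LinearMap.mulLeft R x) J

lemma mem_col {J : Ideal R} {x a : R} : a ∈ col J x ↔ x * a ∈ J := Iff.rfl

lemma le_col (J : Ideal R) (x : R) : J ≤ col J x := fun _ ha => mem_col.2 (J.mul_mem_left _ ha)

/-- the basic sequence -/
abbrev bseq (J : Ideal R) (x : R) : ShortComplex (ModuleCat.{u} R) :=
  ShortComplex.mk (mu x (col J x) J (fun _ h => mem_col.1 h))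
    (mu 1 J (J ⊔ Ideal.span {x}) (fun _ h => by simpa using Ideal.mem_sup_left h)) (by
      rw [mu_comp]
      ext
      simp only [mul_one]
      refine (Submodule.Quotient.mk_eq_zero _).2 ?_
      simpa using Ideal.mem_sup_right (Ideal.mem_span_singleton_self x))

lemma bseq_exact (J : Ideal R) (x : R) : (bseq J x).ShortExact := by
  refine ShortComplex.ShortExact.mk' ?_ ?_ ?_
  · rw [ShortComplex.moduleCat_exact_iff]
    intro y hy
    obtain ⟨a, rfl⟩ := Submodule.Quotient.mk_surjective _ y
    have : a ∈ J ⊔ Ideal.span {x} := by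
      have := (Submodule.Quotient.mk_eq_zero (J ⊔ Ideal.span {x})).1 hy
      simpa using this
    obtain ⟨b, hb, c, hc, rfl⟩ := Submodule.mem_sup.1 this
    obtain ⟨d, rfl⟩ := Ideal.mem_span_singleton'.1 hc
    refine ⟨Submodule.Quotient.mk d, ?_⟩
    refine (Submodule.Quotient.eq J).2 ?_
    have : x * d - (b + d * x) = - b := by ring
    simpa [this] using hb
  · rw [ModuleCat.mono_iff_injective]
    refine (injective_iff_map_eq_zero (mu x (col J x) J (fun _ h => mem_col.1 h)).hom).2 ?_
    intro y hy
    obtain ⟨a, rfl⟩ := Submodule.Quotient.mk_surjective _ y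
    exact (Submodule.Quotient.mk_eq_zero _).2 ((Submodule.Quotient.mk_eq_zero J).1 hy)
  · rw [ModuleCat.epi_iff_surjective]
    intro y
    obtain ⟨a, rfl⟩ := Submodule.Quotient.mk_surjective _ y
    refine ⟨Submodule.Quotient.mk a, ?_⟩
    refine (Submodule.Quotient.eq _).2 ?_
    simp

/-- the ideal generated by `t`-th powers of the elements of `l` -/
def Jt : List R → ℕ → Ideal R
  | [], _ => ⊥
  | x :: l, t => Jt l t ⊔ Ideal.span {x ^ t}

lemma Jt_anti (l : List R) {s t : ℕ} (h : t ≤ s) : Jt l s ≤ Jt l t := by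
  induction l with
  | nil => exact le_rfl
  | cons x l ih => 
    exact sup_le_sup ih (by
      rw [Ideal.span_singleton_le_span_singleton]; exact pow_dvd_pow _ h)

lemma stab [IsNoetherianRing R] (J : Ideal R) (x : R) : ∃ N, ∀ m, N ≤ m → ∀ k a, 
    x ^ k * a ∈ J → x ^ m * a ∈ J := by
  obtain ⟨N, hN⟩ := monotone_stabilizes_iff_noetherian.2 (inferInstance : IsNoetherian R R)
    ⟨fun k => col J (x ^ k), fun k l h a ha => by
      obtain ⟨d, rfl⟩ := Nat.exists_eq_add_of_le h
      rw [mem_col] at *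
      rw [pow_add, mul_comm (x ^ k), mul_assoc]
      exact J.mul_mem_left _ ha⟩
  refine ⟨N, fun m hm k a h => ?_⟩
  have hk : a ∈ col J (x ^ (k + m)) := by
    rw [mem_col, pow_add, mul_comm (x ^ k), mul_assoc]
    exact J.mul_mem_left _ h
  have h1 := hN m hm
  have h2 := hN (k + m) (by lia)
  have h3 : col J (x ^ (k + m)) = col J (x ^ m) := h2.symm.trans h1
  rw [h3] at hk
  exact mem_col.1 hk

lemma sup_anti {J : ℕ → Ideal R} (hJ : ∀ {s t : ℕ}, t ≤ s → J s ≤ J t) (x : R) {s t : ℕ}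
    (h : t ≤ s) : J s ⊔ Ideal.span {x ^ s} ≤ J t ⊔ Ideal.span {x ^ t} :=
  sup_le_sup (hJ h) (by
      rw [Ideal.span_singleton_le_span_singleton]; exact pow_dvd_pow _ h)

lemma kill_step [IsNoetherianRing R] {J : ℕ → Ideal R} (hJ : ∀ {s t : ℕ}, t ≤ s → J s ≤ J t)
    (x : R) (n : ℕ) (ih : ∀ t, ∃ s, ∃ h : t ≤ s, Kill (tr (hJ h)) n) : ∀ t, ∃ s, ∃ h : t ≤ s,
    Kill (tr (sup_anti hJ x h)) (n + 1) := by
  intro t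
  obtain ⟨s, hs, k1⟩ := ih t
  obtain ⟨u, hu, k2⟩ := ih s
  obtain ⟨N, hN⟩ := stab (J u) x
  let s' := u + s + N
  have hs' : s ≤ s' := by lia
  refine ⟨s', hs.trans hs', ?_⟩
  intro i hi Y α
  obtain ⟨i, rfl⟩ : ∃ k, i = 1 + k := ⟨i - 1, by lia⟩
  have hi' : n < i := by lia
  have h1 : (mk₀ (bseq (J s) (x ^ s)).g).comp ((mk₀ (tr (sup_anti hJ x hs))).comp α (zero_add _)) (zero_add _) = 0 := by
    rw [Abelian.Ext.mk₀_comp_mk₀_assoc]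
    have : (bseq (J s) (x ^ s)).g ≫ tr (sup_anti hJ x hs) = tr (hJ hs) ≫ (bseq (J t) (x ^ t)).g := by
      rw [tr_eq_mu, tr_eq_mu]
      exact (mu_comp ..).trans (mu_comp ..).symm
    rw [this]
    exact (k1.comp_right _) _ (by lia) _ _
  obtain ⟨β, hβ⟩ := Abelian.Ext.contravariant_sequence_exact₃ (bseq_exact _ _) _ _ h1 rfl
  have c1 : ∀ a ∈ col (J s') (x ^ s'), x ^ (s' - s) * a ∈ J u := by
    intro a ha
    exact hN _ (by lia) _ _ (hJ (by lia) ha)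
  let κ : (bseq (J s') (x ^ s')).X₁ ⟶ (bseq (J s) (x ^ s)).X₁ := mu (x ^ (s' - s)) (col (J s') (x ^ s')) (J u) c1 ≫
    tr (hJ hu) ≫ tr (le_col (J s) (x ^ s))
  let Φ : bseq (J s') (x ^ s') ⟶ bseq (J s) (x ^ s) :=
    { τ₁ := κ
      τ₂ := tr (hJ hs')
      τ₃ := tr (sup_anti hJ x hs')
      comm₁₂ := by
        have this : x ^ (s' - s) * x ^ s = x ^ s' := by rw [← pow_add]; congr 1; lia
        have e1 : κ = mu (x ^ (s' - s) * (1 * 1)) (col (J s') (x ^ s')) (col (J s) (x ^ s))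
            (fun a ha => by
              rw [mul_one, mul_one]
              exact (J s).mul_mem_left _ (hJ hu (c1 a ha))) := by
          change mu (x ^ (s' - s)) (col (J s') (x ^ s')) (J u) c1 ≫ tr (hJ hu) ≫
            tr (I := J s) (J := col (J s) (x ^ s)) (le_col _ _) = _
          rw [tr_eq_mu, tr_eq_mu, mu_comp, mu_comp]
        rw [e1, tr_eq_mu]
        refine (mu_comp ..).trans (Eq.trans ?_ (mu_comp ..).symm)
        exact mu_congr (by rw [mul_one, mul_one, mul_one]; exact this) _ _ _ _
      comm₂₃ := by
        rw [tr_eq_mu, tr_eq_mu]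
        exact (mu_comp ..).trans (mu_comp ..).symm }
  have hk : (mk₀ κ).comp β (zero_add _) = 0 :=
    ((k2.comp_right _).comp_left _) _ hi' _ _
  rw [← tr_comp (sup_anti hJ x hs') (sup_anti hJ x hs), ← Abelian.Ext.mk₀_comp_mk₀_assoc,
    ← hβ]
  have nat := ShortComplex.ShortExact.extClass_naturality (bseq_exact _ _) (bseq_exact _ _) Φ
  rw [← Abelian.Ext.comp_assoc _ _ _ (zero_add _) rfl (by lia)]
  refine (congrArg (fun z => Abelian.Ext.comp z β rfl) nat.symm).trans ?_
  dsimp only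
  rw [Abelian.Ext.comp_assoc _ _ _ (add_zero _) (zero_add _) (by lia)]
  refine (congrArg (fun z => Abelian.Ext.comp _ z rfl) hk).trans ?_
  exact Abelian.Ext.comp_zero ..

lemma kill_exists [IsNoetherianRing R] (l : List R) : ∀ t, ∃ s, ∃ h : t ≤ s,
    Kill (tr (Jt_anti l h)) l.length := by
  induction l with
  | nil =>
    intro t
    refine ⟨t, le_rfl, ?_⟩
    intro i hi Y α
    obtain ⟨i, rfl⟩ : ∃ k, i = k + 1 := ⟨i - 1, by simp at hi; lia⟩
    have : Projective (ModuleCat.of R (R ⧸ (Jt ([] : List R) t))) := by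
      rw [← IsProjective.iff_projective]
      exact Module.Projective.of_equiv (Submodule.quotEquivOfEqBot (⊥ : Ideal R) rfl).symm
    exact Abelian.Ext.eq_zero_of_projective _
  | cons x l ih => exact kill_step (Jt_anti l) x _ ih

lemma Jt_le (l : List R) (t : ℕ) (I : Ideal R) (hl : ∀ x ∈ l, x ∈ I) : Jt l t ≤ I ^ t := by
  induction l with
  | nil => exact bot_le
  | cons x l ih =>
    refine sup_le (ih fun y hy => hl y (by simp [hy])) ?_
    rw [Ideal.span_singleton_le_iff_mem]
    exact Ideal.pow_mem_pow (hl x (by simp)) t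

lemma mem_Jt (l : List R) (t : ℕ) (x : R) (hx : x ∈ l) : x ^ t ∈ Jt l t := by
  induction l with
  | nil => simp at hx
  | cons y l ih =>
    rcases List.mem_cons.1 hx with rfl | h
    · exact Ideal.mem_sup_right (Ideal.mem_span_singleton_self _)
    · exact Ideal.mem_sup_left (ih h)

lemma van_large [IsNoetherianRing R] (I : Ideal R) : ∃ n, ∀ j, n < j → ∀ Y, Van I j Y := by
  obtain ⟨F, hF⟩ := (isNoetherianRing_iff_ideal_fg R).1 inferInstance I
  refine ⟨F.toList.length, fun j hj Y t α => ?_⟩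
  obtain ⟨s, hs, k⟩ := kill_exists F.toList t
  have hI : I ≤ (Jt F.toList s).radical := by
    rw [← hF, Ideal.span_le]
    intro x hx
    exact ⟨s, mem_Jt _ _ _ (by simpa using hx)⟩
  obtain ⟨r, hr⟩ := Ideal.exists_pow_le_of_le_radical_of_fg hI ⟨F, hF⟩
  have hle := Jt_le F.toList t I (fun x hx => by
    rw [← hF]; exact Ideal.subset_span (by simpa using hx))
  refine ⟨r + t, by lia, ?_⟩
  have : tr (Ideal.pow_le_pow_right (I := I) (show t ≤ r + t by lia)) =
    tr ((Ideal.pow_le_pow_right (I := I) (show r ≤ r + t by lia)).trans hr) ≫ 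
      tr (Jt_anti F.toList hs) ≫ tr hle := by
    simp only [tr_comp]
  rw [this]
  exact ((k.comp_right _).comp_left _) _ hj _ _
end
end LC


namespace LC
open Limits Opposite
open Abelian (Ext)
open Abelian.Ext (mk₀)
section
variable {R : Type u} [CommRing R]

lemma van_sub (I : Ideal R) (j : ℕ) (X : Type u) [AddCommGroup X] [Module R X] [Subsingleton X] :
    Van I j (ModuleCat.of R X) := by
  intro t α
  refine ⟨t, le_rfl, ?_⟩
  have hz : IsZero (ModuleCat.of R X) := ModuleCat.isZero_of_subsingleton _
  have h : α = α.comp (mk₀ (𝟙 (ModuleCat.of R X))) (add_zero _) := by simp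
  rw [hz.eq_of_src (𝟙 _) 0] at h
  simp at h
  rw [h, Abelian.Ext.comp_zero]

section
variable {X Y Z : Type u} [AddCommGroup X] [Module R X] [AddCommGroup Y] [Module R Y]
  [AddCommGroup Z] [Module R Z]

/-- short complex from linear maps -/
abbrev sc (f : X →ₗ[R] Y) (g : Y →ₗ[R] Z) (h : Function.Exact f g) :
    ShortComplex (ModuleCat.{u} R) :=
  ShortComplex.mk (ModuleCat.ofHom f) (ModuleCat.ofHom g) (by
    ext x; exact h.apply_apply_eq_zero x)

lemma sc_exact (f : X →ₗ[R] Y) (g : Y →ₗ[R] Z) (h : Function.Exact f g)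
    (hf : Function.Injective f) (hg : Function.Surjective g) : (sc f g h).ShortExact := by
  refine ShortComplex.ShortExact.mk' ?_ ?_ ?_
  · rw [ShortComplex.moduleCat_exact_iff]
    intro y hy
    exact (h y).1 hy
  · rw [ModuleCat.mono_iff_injective]; exact hf
  · rw [ModuleCat.epi_iff_surjective]; exact hg

lemma van_mid_lin (I : Ideal R) (j : ℕ) (f : X →ₗ[R] Y) (g : Y →ₗ[R] Z)
    (hf : Function.Injective f) (hg : Function.Surjective g) (h : Function.Exact f g)
    (h1 : Van I j (ModuleCat.of R X)) (h3 : Van I j (ModuleCat.of R Z)) :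
    Van I j (ModuleCat.of R Y) := van_mid I j (sc_exact f g h hf hg) h1 h3

lemma van_right_lin (I : Ideal R) (j : ℕ) (f : X →ₗ[R] Y) (g : Y →ₗ[R] Z)
    (hf : Function.Injective f) (hg : Function.Surjective g) (h : Function.Exact f g)
    (h1 : Van I (j + 1) (ModuleCat.of R X)) (h2 : Van I j (ModuleCat.of R Y)) :
    Van I j (ModuleCat.of R Z) := van_right I j (sc_exact f g h hf hg) h1 h2

lemma van_equiv (I : Ideal R) (j : ℕ) (e : X ≃ₗ[R] Y) (h : Van I j (ModuleCat.of R X)) :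
    Van I j (ModuleCat.of R Y) := by
  refine van_mid_lin I j e.toLinearMap (0 : Y →ₗ[R] PUnit.{u+1}) e.injective
    (fun _ => ⟨0, Subsingleton.elim _ _⟩) ?_ h (van_sub I j _)
  intro y
  simp

end

/-- A prime filtration argument -/
lemma van_filtration [IsNoetherianRing R] (I : Ideal R) (j : ℕ) (A : Ideal R)
    (hp : ∀ q : Ideal R, q.IsPrime → A ≤ q → Van I j (ModuleCat.of R (R ⧸ q)))
    (X : Type u) [AddCommGroup X] [Module R X] [hX : Module.Finite R X]
    (hA : A ≤ Module.annihilator R X) : Van I j (ModuleCat.of R X) := by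
  revert hA
  refine IsNoetherianRing.induction_on_isQuotientEquivQuotientPrime R hX
    (motive := fun N _ _ _ => A ≤ Module.annihilator R N → Van I j (ModuleCat.of R N)) ?_ ?_ ?_
  · intro N _ _ _ _ _
    exact van_sub I j N
  · intro N _ _ _ p e hA
    refine van_equiv I j e.symm (hp p.1 p.2 ?_)
    rw [e.annihilator_eq, Ideal.annihilator_quotient] at hA
    exact hA
  · intro N₁ _ _ _ N₂ _ _ _ N₃ _ _ _ f g hf hg hfg h1 h3 hA
    exact van_mid_lin I j f g hf hg hfg (h1 (hA.trans (f.annihilator_le_of_injective hf)))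
      (h3 (hA.trans (g.annihilator_le_of_surjective hg)))

lemma van_step [IsNoetherianRing R] (I : Ideal R) (j : ℕ)
    (L : Type u) [AddCommGroup L] [Module R L] [Module.Finite R L]
    (hL : Van I j (ModuleCat.of R L))
    (ih : ∀ (X : Type u) [AddCommGroup X] [Module R X] [Module.Finite R X],
      Module.annihilator R L ≤ Module.annihilator R X → Van I (j + 1) (ModuleCat.of R X))
    (q : Ideal R) (hq : Module.annihilator R L ≤ q) : Van I j (ModuleCat.of R (R ⧸ q)) := by
  induction q using IsNoetherian.induction with
  | _ q IH =>
  by_cases ht : q = ⊤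
  · subst ht
    have : Subsingleton (R ⧸ (⊤ : Ideal R)) := Ideal.Quotient.subsingleton_iff.2 rfl
    exact van_sub I j _
  by_cases hpr : Ideal.IsPrime q
  · have hne : Nontrivial (L →ₗ[R] R ⧸ q) := by
      by_contra hcon
      rw [not_nontrivial_iff_subsingleton, IsSMulRegular.subsingleton_linearMap_iff] at hcon
      obtain ⟨r, hr, hreg⟩ := hcon
      have h1 : r • (1 : R ⧸ q) = r • (0 : R ⧸ q) := by
        rw [smul_zero, Algebra.smul_def, mul_one]
        exact Ideal.Quotient.eq_zero_iff_mem.2 (hq hr)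
      have := Ideal.Quotient.nontrivial_iff.2 ht
      exact one_ne_zero (hreg h1)
    obtain ⟨f, hf⟩ := exists_ne (0 : L →ₗ[R] R ⧸ q)
    have h1 : Van I j (ModuleCat.of R (LinearMap.range f)) := by
      refine van_right_lin I j (LinearMap.ker f).subtype f.rangeRestrict
        (Submodule.subtype_injective _) f.surjective_rangeRestrict ?_ (ih _ ?_) hL
      · rw [LinearMap.exact_iff]; simp
      · exact LinearMap.annihilator_le_of_injective (LinearMap.ker f).subtype
          (Submodule.subtype_injective _)
    let J : Ideal R := (LinearMap.range f).comap (Submodule.mkQ q)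
    have hqJ : q < J := by
      refine lt_of_le_of_ne (fun a ha => ?_) ?_
      · change (Submodule.Quotient.mk a : R ⧸ q) ∈ LinearMap.range f
        rw [(Submodule.Quotient.mk_eq_zero q).2 ha]
        exact zero_mem _
      · intro h
        apply hf
        ext x
        obtain ⟨a, ha⟩ := Submodule.mkQ_surjective q (f x)
        have : a ∈ J := by
          change Submodule.mkQ q a ∈ LinearMap.range f
          rw [ha]; exact ⟨x, rfl⟩
        rw [← h] at this
        rw [← ha]
        exact (Submodule.Quotient.mk_eq_zero q).2 this
    refine van_mid_lin I j (LinearMap.range f).subtype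
      (Submodule.mapQ q J LinearMap.id hqJ.le) (Submodule.subtype_injective _) ?_ ?_ h1
      (IH J hqJ (hq.trans hqJ.le))
    · intro y
      obtain ⟨a, rfl⟩ := Submodule.Quotient.mk_surjective _ y
      exact ⟨Submodule.Quotient.mk a, rfl⟩
    · intro y
      obtain ⟨a, rfl⟩ := Submodule.Quotient.mk_surjective _ y
      have : (Submodule.mapQ q J LinearMap.id hqJ.le) (Submodule.Quotient.mk a) = 0 ↔ a ∈ J :=
        Submodule.Quotient.mk_eq_zero J
      rw [this]
      simp [J]
  · obtain ⟨x, hx, y, hy, hxy⟩ := (Ideal.not_isPrime_iff.1 hpr).resolve_left ht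
    have hc : q < col q x := lt_of_le_of_ne (le_col q x) fun h => hy (by
      rw [h]; exact mem_col.2 hxy)
    have hs : q < q ⊔ Ideal.span {x} := lt_of_le_of_ne le_sup_left fun h => hx (by
      rw [h]; exact Ideal.mem_sup_right (Ideal.mem_span_singleton_self x))
    exact van_mid I j (bseq_exact q x) (IH _ hc (hq.trans hc.le)) (IH _ hs (hq.trans hs.le))

theorem van_key [IsNoetherianRing R] (I : Ideal R) (i : ℕ)
    (L : Type u) [AddCommGroup L] [Module R L] [Module.Finite R L]
    (hL : ∀ j, i < j → Van I j (ModuleCat.of R L)) 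
    (X : Type u) [AddCommGroup X] [Module R X] [Module.Finite R X]
    (hX : Module.annihilator R L ≤ Module.annihilator R X) (j : ℕ) (hj : i < j) :
    Van I j (ModuleCat.of R X) := by
  obtain ⟨n, hn⟩ := van_large I
  suffices h : ∀ k j, i < j → n < j + k →
      ∀ (X : Type u) [AddCommGroup X] [Module R X] [Module.Finite R X],
      Module.annihilator R L ≤ Module.annihilator R X → Van I j (ModuleCat.of R X) from
    h (n + 1) j hj (by lia) X hX
  intro k
  induction k with
  | zero => intro j _ h X _ _ _ _; exact hn j h _
  | succ k ih =>
    intro j hj hk X _ _ _ hX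
    exact van_filtration I j _ (fun q _ hq => van_step I j L (hL j hj)
      (fun X _ _ _ hX => ih (j + 1) (by lia) (by lia) X hX) q hq) X hX

end
end LC

namespace LC
section
variable {R : Type u} [CommRing R]

lemma cohDim_le_iff (I : Ideal R) (X : Type u) [AddCommGroup X] [Module R X] (i : ℕ) :
    cohDim I X ≤ ((i : ℕ∞) : WithBot ℕ∞) ↔ ∀ j, i < j → Van I j (ModuleCat.of R X) := by
  have key : cohDim I X ≤ ((i : ℕ∞) : WithBot ℕ∞) ↔ ∀ j, LCNonzero I j X → j ≤ i := by
    unfold cohDim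
    rw [sSup_le_iff]
    constructor
    · intro h j hj
      have := h _ ⟨j, rfl, hj⟩
      exact_mod_cast this
    · rintro h _ ⟨j, rfl, hj⟩
      exact_mod_cast h j hj
  rw [key]
  refine forall_congr' fun j => ?_
  constructor
  · intro h hij
    obtain ⟨k, rfl⟩ : ∃ k, j = k + 1 := ⟨j - 1, by lia⟩
    rw [← van_iff, ← not_nontrivial_iff_subsingleton]
    intro hn
    have := h hn
    lia
  · intro h hn
    by_contra hij
    have hv := h (by lia)
    obtain ⟨k, rfl⟩ : ∃ k, j = k + 1 := ⟨j - 1, by lia⟩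
    rw [← van_iff] at hv
    exact not_nontrivial_iff_subsingleton.2 hv hn

/-- Cohomological dimension of `R/q` is bounded by that of any finite `L` with `q ⊇ Ann L`. -/
lemma cohDim_quot_le [IsNoetherianRing R] (I : Ideal R) (i : ℕ)
    (L : Type u) [AddCommGroup L] [Module R L] [Module.Finite R L]
    (hL : cohDim I L ≤ ((i : ℕ∞) : WithBot ℕ∞)) (q : Ideal R) (hq : Module.annihilator R L ≤ q) :
    cohDim I (R ⧸ q) ≤ ((i : ℕ∞) : WithBot ℕ∞) := by
  rw [cohDim_le_iff] at hL ⊢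
  exact van_key I i L hL (R ⧸ q) (by rwa [Ideal.annihilator_quotient])

lemma cohDim_le_of_primes [IsNoetherianRing R] (I : Ideal R) (i : ℕ)
    (K : Type u) [AddCommGroup K] [Module R K] [Module.Finite R K]
    (h : ∀ q : Ideal R, q.IsPrime → Module.annihilator R K ≤ q →
      cohDim I (R ⧸ q) ≤ ((i : ℕ∞) : WithBot ℕ∞)) :
    cohDim I K ≤ ((i : ℕ∞) : WithBot ℕ∞) := by
  rw [cohDim_le_iff]
  intro j hj
  exact van_filtration I j _ (fun q hq hA => (cohDim_le_iff I _ i).1 (h q hq hA) j hj) K le_rfl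

variable {M : Type u} [AddCommGroup M] [Module R M]

lemma primary_zd [IsNoetherianRing R] {N : Submodule R M} {p : Ideal R}
    (h : IsPrimarySubmodule N p) {r : R} {x : M} (hr : r • x ∈ N) (hx : x ∉ N) : r ∈ p := by
  have h1 := biUnion_associatedPrimes_eq_zero_divisors R (M ⧸ N)
  have h2 : r ∈ { r : R | ∃ x : M ⧸ N, x ≠ 0 ∧ r • x = 0 } :=
    ⟨Submodule.Quotient.mk x, fun h => hx ((Submodule.Quotient.mk_eq_zero N).1 h), by
      rw [← Submodule.Quotient.mk_smul]; exact (Submodule.Quotient.mk_eq_zero N).2 hr⟩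
  rw [← h1] at h2
  unfold IsPrimarySubmodule at h
  rw [h] at h2
  simpa using h2

lemma primary_prime {N : Submodule R M} {p : Ideal R}
    (h : IsPrimarySubmodule N p) : p.IsPrime := by
  have : p ∈ associatedPrimes R (M ⧸ N) := by
    unfold IsPrimarySubmodule at h
    rw [h]; rfl
  exact IsAssociatedPrime.isPrime this

lemma primary_pow [IsNoetherianRing R] [Module.Finite R M] {N : Submodule R M} {p : Ideal R}
    (h : IsPrimarySubmodule N p) : ∃ s : ℕ, ∀ r ∈ p ^ s, ∀ x : M, r • x ∈ N := by
  have h1 : p ≤ (Module.annihilator R (M ⧸ N)).radical := by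
    rw [← Ideal.sInf_minimalPrimes]
    refine le_sInf fun q hq => ?_
    have := Module.associatedPrimes.minimalPrimes_annihilator_subset_associatedPrimes R (M ⧸ N) hq
    unfold IsPrimarySubmodule at h
    rw [h] at this
    exact (Set.mem_singleton_iff.1 this).ge
  obtain ⟨s, hs⟩ := Ideal.exists_pow_le_of_le_radical_of_fg h1 (IsNoetherian.noetherian p)
  refine ⟨s, fun r hr x => ?_⟩
  have := Module.mem_annihilator.1 (hs hr) (Submodule.Quotient.mk x)
  rw [← Submodule.Quotient.mk_smul] at this
  exact (Submodule.Quotient.mk_eq_zero N).1 this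

end
end LC

open scoped Classical in
/-- Given a reduced primary decomposition `0 = ⋂ N j` of `0` in `M`, the largest submodule
`Mi` of `M` with `cd(𝔞, Mi) ≤ i` equals the `𝔞ᵢ`-torsion `H^0_{𝔞ᵢ}(M)`, where
`𝔞ᵢ = ∏_{cd(𝔞, R/p j) ≤ i} p j`, and equals `⋂_{cd(𝔞, R/p j) > i} N j`. -/
theorem stmt_2 {R : Type u} [CommRing R] [IsNoetherianRing R] (𝔞 : Ideal R)
    (M : Type u) [AddCommGroup M] [Module R M] [Module.Finite R M] [Nontrivial M]
    (c : ℕ) (hc : cohDim 𝔞 M = (c : ℕ∞))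
    (n : ℕ) (N : Fin n → Submodule R M) (p : Fin n → Ideal R)
    (hdec : (⨅ j, N j) = ⊥) (hprim : ∀ j, IsPrimarySubmodule (N j) (p j))
    (hdist : Function.Injective p)
    (hred : ∀ j, (⨅ k ∈ ({j}ᶜ : Set (Fin n)), N k) ≠ ⊥)
    (i : ℕ) (hi : i ≤ c)
    (Mi : Submodule R M) (hMi : cohDim 𝔞 ↥Mi ≤ (i : ℕ∞))
    (hMimax : ∀ L : Submodule R M, cohDim 𝔞 ↥L ≤ (i : ℕ∞) → L ≤ Mi) :
    (∀ x : M, x ∈ Mi ↔ ∃ s : ℕ,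
        ∀ r ∈ (∏ j ∈ Finset.univ.filter (fun j => cohDim 𝔞 (R ⧸ p j) ≤ (i : ℕ∞)), p j) ^ s,
          r • x = (0 : M)) ∧
    Mi = ⨅ j ∈ {j : Fin n | ((i : ℕ∞) : WithBot ℕ∞) < cohDim 𝔞 (R ⧸ p j)}, N j := by
  classical
  have hpr : ∀ j, (p j).IsPrime := fun j => LC.primary_prime (hprim j)
  set 𝔟 : Ideal R :=
    ∏ j ∈ Finset.univ.filter (fun j => cohDim 𝔞 (R ⧸ p j) ≤ (i : ℕ∞)), p j with hb
  set K : Submodule R M :=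
    ⨅ j ∈ {j : Fin n | ((i : ℕ∞) : WithBot ℕ∞) < cohDim 𝔞 (R ⧸ p j)}, N j with hK
  have memK : ∀ x, x ∈ K ↔ ∀ j, ((i : ℕ∞) : WithBot ℕ∞) < cohDim 𝔞 (R ⧸ p j) → x ∈ N j := by
    intro x
    simp [hK, Submodule.mem_iInf]
  -- primes containing `𝔟`
  have hprime : ∀ q : Ideal R, q.IsPrime → 𝔟 ≤ q →
      cohDim 𝔞 (R ⧸ q) ≤ ((i : ℕ∞) : WithBot ℕ∞) := by
    intro q hq hbq
    obtain ⟨k, hk, hkq⟩ := hq.prod_le.1 hbq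
    exact LC.cohDim_quot_le 𝔞 i (R ⧸ p k) (Finset.mem_filter.1 hk).2 q
      (by rwa [Ideal.annihilator_quotient])
  have h1 : Mi ≤ K := by
    intro x hx
    rw [memK]
    intro j hj
    by_contra hxN
    refine absurd (LC.cohDim_quot_le 𝔞 i Mi hMi (p j) ?_) (not_le.2 hj)
    intro r hr
    refine LC.primary_zd (hprim j) (x := x) ?_ hxN
    have h0 : r • (⟨x, hx⟩ : Mi) = 0 := Module.mem_annihilator.1 hr _
    have h0' : r • x = 0 := congrArg Subtype.val h0
    rw [h0']
    exact zero_mem _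
  have h2 : ∃ s : ℕ, ∀ x ∈ K, ∀ r ∈ 𝔟 ^ s, r • x = (0 : M) := by
    choose s hs using fun j => LC.primary_pow (hprim j)
    refine ⟨∑ j, s j, fun x hx r hr => ?_⟩
    rw [← Submodule.mem_bot R, ← hdec, Submodule.mem_iInf]
    intro j
    by_cases hj : cohDim 𝔞 (R ⧸ p j) ≤ ((i : ℕ∞) : WithBot ℕ∞)
    · refine hs j r ?_ x
      have hbp : 𝔟 ≤ p j := by
        refine (hpr j).prod_le.2 ⟨j, ?_, le_rfl⟩
        simpa using hj
      have hle : s j ≤ ∑ j, s j :=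
        Finset.single_le_sum (f := s) (fun _ _ => Nat.zero_le _) (Finset.mem_univ j)
      exact Ideal.pow_le_pow_right hle (Ideal.pow_right_mono hbp _ hr)
    · exact (N j).smul_mem r ((memK x).1 hx j (not_le.1 hj))
  have h3 : K ≤ Mi := by
    apply hMimax
    apply LC.cohDim_le_of_primes
    intro q hq hA
    obtain ⟨s, hs⟩ := h2
    refine hprime q hq (hq.le_of_pow_le (n := s) (le_trans ?_ hA))
    intro r hr
    refine Module.mem_annihilator.2 fun x => Subtype.ext ?_
    exact hs x.1 x.2 r hr
  have h4 : Mi = K := le_antisymm h1 h3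
  refine ⟨fun x => ⟨fun hx => ?_, ?_⟩, h4⟩
  · obtain ⟨s, hs⟩ := h2
    exact ⟨s, hs x (h1 hx)⟩
  · rintro ⟨s, hs⟩
    rw [h4, memK]
    intro j hj
    by_contra hxN
    refine absurd (hprime (p j) (hpr j) ?_) (not_le.2 hj)
    refine (hpr j).le_of_pow_le (n := s) ?_
    intro r hr
    refine LC.primary_zd (hprim j) (x := x) ?_ hxN
    rw [hs r hr]
    exact zero_mem _
end

section
/- Let R be Noetherian, 𝔞 an ideal, M a nonzero finitely generated R-module with c = cd(𝔞, M) finite, and M_i the largest submodule of M with cd(𝔞, M_i) ≤ i. Then Ass_R(M/M_i) = {𝔭 ∈ Ass_R(M) : cd(𝔞, R/𝔭) > i}. -/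
open CategoryTheory

universe u

section helpers
open CategoryTheory Limits Opposite
theorem lc_iff {R : Type u} [CommRing R] (I : Ideal R) (i : ℕ) (M : Type u) [AddCommGroup M] [Module R M] : 
  ¬ LCNonzero I i M ↔ ∀ t : ℕ, ∀ e : ((Ext R (ModuleCat.{u} R) i).obj (op (ModuleCat.of R (R ⧸ I ^ t)))).obj (ModuleCat.of R M), ∃ s, ∃ h : t ≤ s, (((Ext R (ModuleCat.{u} R) i).map (ModuleCat.ofHom (Submodule.mapQ _ _ LinearMap.id (Ideal.pow_le_pow_right h : I ^ s ≤ I ^ t))).op).app (ModuleCat.of R M)).hom e = 0 := by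
  have hc := isColimitOfPreserves ((evaluation _ _).obj (ModuleCat.of R M)) (colimit.isColimit (localCohomology.diagram (localCohomology.idealPowersDiagram I) i))
  have : PreservesFilteredColimitsOfSize.{0,0} (forget (ModuleCat.{u} R)) := preservesFilteredColimitsOfSize_shrink.{0,u,0,u} _
  rw [not_nontrivial_iff_subsingleton]
  constructor
  · intro hs t e
    have h0 := (Concrete.isColimit_rep_eq_iff_exists _ hc (i := op (op t)) (j := op (op t)) e 0).1 
      (@Subsingleton.elim _ hs _ _)
    obtain ⟨k, f, g, h⟩ := h0
    refine ⟨k.unop.unop, f.unop.unop.down.down, ?_⟩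
    refine Eq.trans h (map_zero _)
  · intro h
    refine subsingleton_of_forall_eq 0 fun x => ?_
    obtain ⟨t, e, he⟩ := Concrete.isColimit_exists_rep _ hc x
    obtain ⟨s, hs, h⟩ := h t.unop.unop e
    rw [← he]
    refine ((Concrete.isColimit_rep_eq_iff_exists _ hc (i := t) (j := t) e 0).2 ⟨op (op s), (homOfLE hs).op.op, (homOfLE hs).op.op, h.trans (map_zero _).symm⟩).trans (map_zero _)

section bridge
variable {R : Type u} [CommRing R] 

/-- `z` represents the homology class `x`. -/
def LCRep {ι : Type} {c : ComplexShape ι} (K : HomologicalComplex (ModuleCat.{u} R) c) (i : ι) (z : K.X i) (x : K.homology i) : Prop :=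
  ∃ y : K.cycles i, (K.iCycles i).hom y = z ∧ (K.homologyπ i).hom y = x

theorem LCRep.map {ι : Type} {c : ComplexShape ι} {K L : HomologicalComplex (ModuleCat.{u} R) c} (φ : K ⟶ L) {i : ι} {z : K.X i} {x : K.homology i} (h : LCRep K i z x) : LCRep L i ((φ.f i).hom z) ((HomologicalComplex.homologyMap φ i).hom x) := by
  obtain ⟨y, rfl, rfl⟩ := h
  refine ⟨(HomologicalComplex.cyclesMap φ i).hom y, ?_, ?_⟩
  · exact congr($(HomologicalComplex.cyclesMap_i φ i).hom y)
  · exact (congr($(HomologicalComplex.homologyπ_naturality φ i).hom y)).symm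

theorem exists_rep {ι : Type} {c : ComplexShape ι} (K : HomologicalComplex (ModuleCat.{u} R) c) (i j : ι) (x : K.homology i) : ∃ z, (K.d i j).hom z = 0 ∧ LCRep K i z x := by
  obtain ⟨y, rfl⟩ := (ModuleCat.epi_iff_surjective (K.homologyπ i)).1 inferInstance x
  refine ⟨_, ?_, y, rfl, rfl⟩
  exact congr($(K.iCycles_d i j).hom y)

theorem exists_rep' {ι : Type} {c : ComplexShape ι} (K : HomologicalComplex (ModuleCat.{u} R) c) (i j : ι) (hj : c.next i = j) (z : K.X i) (hz : (K.d i j).hom z = 0) : ∃ x, LCRep K i z x := by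
  refine ⟨_, K.cyclesMk z j hj hz, ?_, rfl⟩
  exact K.i_cyclesMk z j hj hz

theorem LCRep.zero_iff {ι : Type} {c : ComplexShape ι} {K : HomologicalComplex (ModuleCat.{u} R) c} {i : ι} {z : K.X i} {x : K.homology i} (h : LCRep K i z x) (j : ι) (hj : c.prev i = j) : x = 0 ↔ ∃ w, (K.d j i).hom w = z := by
  obtain ⟨y, rfl, rfl⟩ := h
  have hex := ShortComplex.exact_of_g_is_cokernel (ShortComplex.mk _ _ (K.toCycles_comp_homologyπ (c.prev i) i)) (K.homologyIsCokernel (c.prev i) i rfl)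
  rw [ShortComplex.moduleCat_exact_iff] at hex
  subst hj
  constructor
  · intro h
    obtain ⟨w, hw⟩ := hex y h
    refine ⟨w, ?_⟩
    change (K.toCycles (c.prev i) i).hom w = y at hw
    rw [← hw]
    exact congr($(K.toCycles_i (c.prev i) i).hom w).symm
  · rintro ⟨w, hw⟩
    have : (K.toCycles (c.prev i) i).hom w = y := by
      apply (ModuleCat.mono_iff_injective (K.iCycles i)).1 inferInstance
      exact (congr($(K.toCycles_i (c.prev i) i).hom w)).trans hw
    rw [← this]
    exact congr($(K.toCycles_comp_homologyπ (c.prev i) i).hom w)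

/-- the map on Hom complexes -/
noncomputable def lyMap {P Q : ChainComplex (ModuleCat.{u} R) ℕ} (φ : P ⟶ Q) (Y : ModuleCat.{u} R) : Q.linearYonedaObj R Y ⟶ P.linearYonedaObj R Y :=
  (HomologicalComplex.unopFunctor _ _).map ((((linearYoneda R (ModuleCat.{u} R)).obj Y).rightOp.mapHomologicalComplex _).map φ).op

theorem iso_aux {D : Type*} [Category D] {A A' B B' C C' : D} (a : A ≅ B) (a' : A' ≅ B') (b : B ≅ C) (b' : B' ≅ C')
    (f : A ⟶ A') (g : B ⟶ B') (h : C ⟶ C') (h1 : f ≫ a'.hom = a.hom ≫ g) (h2 : b.inv ≫ g = h ≫ b'.inv) :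
    f ≫ (a' ≪≫ b').hom = (a ≪≫ b).hom ≫ h := by
  have h3 : g ≫ b'.hom = b.hom ≫ h := by
    rw [Iso.inv_comp_eq] at h2
    simp [h2]
  simp [reassoc_of% h1, h3]

theorem isoExt_nat {X X' : ModuleCat.{u} R} (g : X' ⟶ X) (P : ProjectiveResolution X) (P' : ProjectiveResolution X')
   (φ : ProjectiveResolution.Hom P' P g) (Y : ModuleCat.{u} R) (n : ℕ) :
   ((Ext R (ModuleCat.{u} R) n).map g.op).app Y ≫ (P'.isoExt n Y).hom = (P.isoExt n Y).hom ≫ HomologicalComplex.homologyMap (lyMap φ.hom Y) n := by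
  have h1 := ProjectiveResolution.isoLeftDerivedObj_inv_naturality g P' P φ.hom (by simpa using φ.hom_f_zero_comp_π_f_zero) ((linearYoneda R (ModuleCat.{u} R)).obj Y).rightOp n
  have h2 := HomologicalComplex.homologyOp_hom_naturality (lyMap φ.hom Y) n
  exact iso_aux _ _ _ _ _ _ _ congr($(h1).unop) congr($(h2).unop)

theorem oldExt_iff {X : ModuleCat.{u} R} (Y : ModuleCat.{u} R) (n : ℕ) {S : Type} (X' : S → ModuleCat.{u} R) (g : ∀ s, X' s ⟶ X) :
   (∀ e : ((Ext R (ModuleCat.{u} R) (n+1)).obj (op X)).obj Y, ∃ s, (((Ext R (ModuleCat.{u} R) (n+1)).map (g s).op).app Y).hom e = 0) ↔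
   (∀ e : Abelian.Ext.{u} X Y (n+1), ∃ s, (Abelian.Ext.mk₀ (g s)).comp e (zero_add _) = 0) := by
  let P := projectiveResolution X
  let P' := fun s => projectiveResolution (X' s)
  let φ : ∀ s, ProjectiveResolution.Hom (P' s) P (g s) := fun s => 
    ⟨ProjectiveResolution.lift (g s) _ _, by simpa using ProjectiveResolution.lift_commutes_zero (g s) (P' s) P⟩
  have key : ∀ s x z, LCRep (P.complex.linearYonedaObj R Y) (n+1) z x → (((((Ext R (ModuleCat.{u} R) (n+1)).map (g s).op).app Y).hom ((P.isoExt (R := R) (n+1) Y).inv.hom x) = 0) ↔ ∃ w : (P' s).complex.X n ⟶ Y, (P' s).complex.d (n+1) n ≫ w = (φ s).hom.f (n+1) ≫ z) := by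
    intro s x z h
    have h1 := (h.map (lyMap (φ s).hom Y)).zero_iff n (by simp)
    refine Iff.trans ?_ h1
    have h2 := isoExt_nat (g s) P (P' s) (φ s) Y (n+1)
    rw [← Iso.inv_comp_eq] at h2
    have h3 := congr(($h2).hom x)
    refine Iff.trans ?_ (Eq.congr h3 rfl)
    have hinj := (ModuleCat.mono_iff_injective ((P' s).isoExt (R := R) (n+1) Y).hom).1 inferInstance
    exact (map_eq_zero_iff ((P' s).isoExt (R := R) (n+1) Y).hom.hom hinj).symm
  constructor
  · intro h e
    obtain ⟨f, hf, rfl⟩ := P.extMk_surjective e (n+2) rfl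
    obtain ⟨x, hx⟩ := exists_rep' (P.complex.linearYonedaObj R Y) (n+1) (n+2) (by simp) f hf
    obtain ⟨s, hs⟩ := h ((P.isoExt (R := R) (n+1) Y).inv.hom x)
    refine ⟨s, ?_⟩
    rw [ProjectiveResolution.mk₀_comp_extMk _ _ _ _ (φ s), ProjectiveResolution.extMk_eq_zero_iff _ _ _ _ _ n rfl]
    exact (key s x f hx).1 hs
  · intro h e
    obtain ⟨x, rfl⟩ := (ModuleCat.epi_iff_surjective (P.isoExt (R := R) (n+1) Y).inv).1 inferInstance e
    obtain ⟨z, hz, hr⟩ := exists_rep _ (n+1) (n+2) x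
    obtain ⟨s, hs⟩ := h (P.extMk z (n+2) rfl hz)
    refine ⟨s, (key s x z hr).2 ?_⟩
    exact (ProjectiveResolution.extMk_eq_zero_iff _ _ _ _ _ n rfl).1
      ((ProjectiveResolution.mk₀_comp_extMk _ _ _ _ (φ s)).symm.trans hs)

/-- transition map -/
noncomputable abbrev tr {I J : Ideal R} (h : I ≤ J) : ModuleCat.of R (R ⧸ I) ⟶ ModuleCat.of R (R ⧸ J) :=
  ModuleCat.ofHom (Submodule.mapQ I J LinearMap.id h)

/-- vanishing of local cohomology in terms of `Abelian.Ext`. -/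
def LCZ (I : Ideal R) (j : ℕ) (Y : ModuleCat.{u} R) : Prop :=
  ∀ t : ℕ, ∀ e : Abelian.Ext.{u} (ModuleCat.of R (R ⧸ I ^ t)) Y j, ∃ s, ∃ h : t ≤ s,
    (Abelian.Ext.mk₀ (tr (Ideal.pow_le_pow_right h : I ^ s ≤ I ^ t))).comp e (zero_add _) = 0

theorem lcz_iff (I : Ideal R) (i : ℕ) (M : Type u) [AddCommGroup M] [Module R M] :
    ¬ LCNonzero I (i+1) M ↔ LCZ I (i+1) (ModuleCat.of R M) := by
  rw [lc_iff, LCZ]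
  refine forall_congr' fun t => ?_
  have := oldExt_iff (ModuleCat.of R M) i (S := {s // t ≤ s}) (fun s => ModuleCat.of R (R ⧸ I ^ s.1)) 
    (fun s => tr (Ideal.pow_le_pow_right s.2 : I ^ s.1 ≤ I ^ t))
  simpa only [Subtype.exists] using this
end bridge

section les
variable {R : Type u} [CommRing R] 
open Abelian

theorem mk₀_tr_tr {I J K : Ideal R} (h : I ≤ J) (h' : J ≤ K) {Y : ModuleCat.{u} R} {j : ℕ} (e : Ext.{u} (ModuleCat.of R (R ⧸ K)) Y j) :
   (Ext.mk₀ (tr h)).comp ((Ext.mk₀ (tr h')).comp e (zero_add _)) (zero_add _) = (Ext.mk₀ (tr (h.trans h'))).comp e (zero_add _) := by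
  rw [Ext.mk₀_comp_mk₀_assoc]
  congr 2
  apply ModuleCat.hom_ext; apply LinearMap.ext; intro x
  obtain ⟨x, rfl⟩ := Submodule.mkQ_surjective _ x
  rfl

theorem LCZ.mid {S : ShortComplex (ModuleCat.{u} R)} (hS : S.ShortExact) {I : Ideal R} {j : ℕ} (h1 : LCZ I j S.X₁) (h3 : LCZ I j S.X₃) : LCZ I j S.X₂ := by
  intro t e
  obtain ⟨s, hs, h⟩ := h3 t (e.comp (Ext.mk₀ S.g) (add_zero _))
  rw [← Ext.comp_assoc _ _ _ (zero_add _) (add_zero _) (by lia)] at h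
  obtain ⟨f, hf⟩ := Ext.covariant_sequence_exact₂ _ hS _ h
  obtain ⟨s', hs', h'⟩ := h1 s f
  refine ⟨s', hs.trans hs', ?_⟩
  rw [← mk₀_tr_tr (Ideal.pow_le_pow_right hs') (Ideal.pow_le_pow_right hs), ← hf, ← Ext.comp_assoc _ _ _ (zero_add _) (add_zero _) (by lia), h', Ext.zero_comp]

theorem LCZ.right {S : ShortComplex (ModuleCat.{u} R)} (hS : S.ShortExact) {I : Ideal R} {j : ℕ} (h1 : LCZ I j S.X₂) (h3 : LCZ I (j+1) S.X₁) : LCZ I j S.X₃ := by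
  intro t e
  obtain ⟨s, hs, h⟩ := h3 t (e.comp hS.extClass rfl)
  rw [← Ext.comp_assoc _ _ _ (zero_add _) rfl (by lia)] at h
  obtain ⟨f, hf⟩ := Ext.covariant_sequence_exact₃ _ hS _ rfl h
  obtain ⟨s', hs', h'⟩ := h1 s f
  refine ⟨s', hs.trans hs', ?_⟩
  rw [← mk₀_tr_tr (Ideal.pow_le_pow_right hs') (Ideal.pow_le_pow_right hs), ← hf, ← Ext.comp_assoc _ _ _ (zero_add _) (add_zero _) (by lia), h', Ext.zero_comp]

/-- uniform pro-vanishing -/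
def PV (b : Ideal R) (n : ℕ) : Prop :=
  ∀ J : Ideal R, b ≤ J.radical → ∃ J' : Ideal R, b ≤ J'.radical ∧ ∃ h : J' ≤ J, 
    ∀ j > n, ∀ Y : ModuleCat.{u} R, ∀ e : Ext.{u} (ModuleCat.of R (R ⧸ J)) Y j, (Ext.mk₀ (tr h)).comp e (zero_add _) = 0

theorem PV.bot : PV (⊥ : Ideal R) 0 := by
  intro J _
  refine ⟨⊥, bot_le, bot_le, fun j hj Y e => ?_⟩
  obtain ⟨j, rfl⟩ : ∃ k, j = k + 1 := ⟨j - 1, by lia⟩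
  have : Projective (ModuleCat.of R (R ⧸ (⊥ : Ideal R))) := by
    have : Module.Projective R (R ⧸ (⊥ : Ideal R)) := Module.Projective.of_equiv (Submodule.quotEquivOfEqBot (⊥ : Ideal R) rfl).symm
    exact (IsProjective.iff_projective _).1 this
  exact Ext.eq_zero_of_projective _

/-- the image of multiplication by `y` on `R/B` -/
abbrev KM (B : Ideal R) (y : R) : Submodule R (R ⧸ B) := LinearMap.range (LinearMap.lsmul R (R ⧸ B) y)

/-- the short complex -/
noncomputable abbrev KS (B : Ideal R) (y : R) : ShortComplex (ModuleCat.{u} R) :=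
  ShortComplex.mk (ModuleCat.ofHom (KM B y).subtype) (tr (le_sup_left : B ≤ B ⊔ Ideal.span {y})) (by
    ext ⟨_, x, rfl⟩
    obtain ⟨x, rfl⟩ := Submodule.mkQ_surjective _ x
    change Submodule.Quotient.mk (y * x) = 0
    rw [Submodule.Quotient.mk_eq_zero]
    exact Ideal.mem_sup_right (Ideal.mul_mem_right _ _ (Ideal.mem_span_singleton_self y)))

theorem KS_exact (B : Ideal R) (y : R) : (KS B y).ShortExact where
  exact := by
    rw [ShortComplex.moduleCat_exact_iff]
    intro x hx
    obtain ⟨x, rfl⟩ := Submodule.mkQ_surjective _ x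
    change Submodule.Quotient.mk x = 0 at hx
    rw [Submodule.Quotient.mk_eq_zero, Submodule.mem_sup] at hx
    obtain ⟨b, hb, z, hz, rfl⟩ := hx
    obtain ⟨a, rfl⟩ := Ideal.mem_span_singleton'.1 hz
    refine ⟨⟨y • Submodule.mkQ B a, _, rfl⟩, ?_⟩
    change y • Submodule.mkQ B a = Submodule.mkQ B (b + a * y)
    have hb0 : Submodule.mkQ B b = 0 := (Submodule.Quotient.mk_eq_zero B).2 hb
    rw [map_add, ← map_smul, hb0, mul_comm, zero_add, smul_eq_mul]
  mono_f := (ModuleCat.mono_iff_injective _).2 Subtype.val_injective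
  epi_g := (ModuleCat.epi_iff_surjective _).2 (by
    intro x
    obtain ⟨x, rfl⟩ := Submodule.mkQ_surjective _ x
    exact ⟨Submodule.mkQ _ x, rfl⟩)

theorem KM_map {B' B : Ideal R} (h : B' ≤ B) {x : R} {t' t : ℕ} (ht : t ≤ t') (z) (hz : z ∈ KM B' (x ^ t')) : Submodule.mapQ B' B LinearMap.id h z ∈ KM B (x ^ t) := by
  obtain ⟨w, rfl⟩ := hz
  refine ⟨x ^ (t' - t) • Submodule.mapQ B' B LinearMap.id h w, ?_⟩
  simp only [LinearMap.lsmul_apply, map_smul, smul_smul, ← pow_add]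
  congr 2
  lia

/-- map of short complexes -/
noncomputable def KS_map {B' B : Ideal R} (h : B' ≤ B) (x : R) {t' t : ℕ} (ht : t ≤ t') : KS B' (x ^ t') ⟶ KS B (x ^ t) where
  τ₁ := ModuleCat.ofHom (LinearMap.restrict _ (KM_map h ht))
  τ₂ := tr h
  τ₃ := tr (sup_le_sup h (by rw [Ideal.span_singleton_le_span_singleton]; exact pow_dvd_pow x ht))
  comm₁₂ := rfl
  comm₂₃ := by
    apply ModuleCat.hom_ext; apply LinearMap.ext; intro z
    obtain ⟨z, rfl⟩ := Submodule.mkQ_surjective _ z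
    rfl

theorem KS_factor [IsNoetherianRing R] {B1 B : Ideal R} (h : B1 ≤ B) (x : R) (t : ℕ) : ∃ t', ∃ ht : t ≤ t', 
   ∃ α : ModuleCat.of R (KM B1 (x ^ t')) ⟶ ModuleCat.of R (R ⧸ B1), ∃ β : ModuleCat.of R (R ⧸ B) ⟶ ModuleCat.of R (KM B (x ^ t)),
     (KS_map h x ht).τ₁ = α ≫ tr h ≫ β := by
  obtain ⟨u, hu⟩ := monotone_stabilizes_iff_noetherian.2 (inferInstance : IsNoetherian R (R ⧸ B1))
    ⟨fun n => LinearMap.ker (LinearMap.lsmul R (R ⧸ B1) (x ^ n)), by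
      intro a b hab z hz
      simp only [LinearMap.mem_ker, LinearMap.lsmul_apply] at hz ⊢
      obtain ⟨c, rfl⟩ := Nat.exists_eq_add_of_le' hab
      rw [pow_add, mul_smul, hz, smul_zero]⟩
  refine ⟨u + t, by lia, ?_⟩
  let f := LinearMap.lsmul R (R ⧸ B1) (x ^ (u+t))
  let α : KM B1 (x ^ (u+t)) →ₗ[R] R ⧸ B1 := (Submodule.liftQ _ (LinearMap.lsmul R (R ⧸ B1) (x ^ u)) (hu (u+t) (by lia)).symm.le).comp f.quotKerEquivRange.symm.toLinearMap
  have hα : ∀ w (hw : (x ^ (u + t)) • w ∈ KM B1 (x ^ (u+t))), α ⟨x ^ (u+t) • w, hw⟩ = x ^ u • w := by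
    intro w hw
    have : f.quotKerEquivRange.symm ⟨x ^ (u+t) • w, hw⟩ = Submodule.Quotient.mk w := by
      rw [LinearEquiv.symm_apply_eq]; rfl
    simp only [α, LinearMap.comp_apply, LinearEquiv.coe_coe]
    erw [this]
    rfl
  refine ⟨ModuleCat.ofHom α, ModuleCat.ofHom (LinearMap.rangeRestrict (LinearMap.lsmul R (R ⧸ B) (x ^ t))), ?_⟩
  ext ⟨_, w, rfl⟩
  change Submodule.mapQ B1 B LinearMap.id h (x ^ (u+t) • w) = x ^ t • Submodule.mapQ B1 B LinearMap.id h (α ⟨x ^ (u+t) • w, _⟩)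
  refine Eq.trans ?_ (congrArg (fun z => x ^ t • Submodule.mapQ B1 B LinearMap.id h z) (hα w ⟨w, rfl⟩)).symm
  rw [← map_smul, smul_smul, ← pow_add, add_comm]

theorem PV.step [IsNoetherianRing R] {b : Ideal R} {n : ℕ} (hb : PV b n) (x : R) : PV (b ⊔ Ideal.span {x}) (n+1) := by
  intro J hJ
  obtain ⟨k, hk⟩ := Ideal.exists_pow_le_of_le_radical_of_fg hJ (IsNoetherian.noetherian _)
  let t := k + 1
  let B := b ^ t
  have hB : b ≤ B.radical := by rw [Ideal.radical_pow b (by lia)]; exact Ideal.le_radical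
  have hBJ : B ⊔ Ideal.span {x ^ t} ≤ J := by
    refine sup_le ?_ ?_
    · exact (Ideal.pow_right_mono le_sup_left _).trans ((Ideal.pow_le_pow_right (by lia)).trans hk)
    · rw [← Ideal.span_singleton_pow]
      exact (Ideal.pow_right_mono le_sup_right _).trans ((Ideal.pow_le_pow_right (by lia)).trans hk)
  obtain ⟨B1, hB1, h1, H1⟩ := hb B hB
  obtain ⟨B2, hB2, h2, H2⟩ := hb B1 hB1
  obtain ⟨t', ht, α, β, hαβ⟩ := KS_factor h2 x t
  have hle1 : B1 ⊔ Ideal.span {x ^ t} ≤ B ⊔ Ideal.span {x ^ t} := sup_le_sup_right h1 _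
  have hle2 : B2 ⊔ Ideal.span {x ^ t'} ≤ B1 ⊔ Ideal.span {x ^ t} := (sup_le_sup h2 (by rw [Ideal.span_singleton_le_span_singleton]; exact pow_dvd_pow x ht))
  refine ⟨B2 ⊔ Ideal.span {x ^ t'}, ?_, hle2.trans (hle1.trans hBJ), ?_⟩
  · refine sup_le (hB2.trans (Ideal.radical_mono le_sup_left)) ?_
    rw [Ideal.span_singleton_le_iff_mem]
    exact ⟨t', Ideal.mem_sup_right (Ideal.mem_span_singleton_self _)⟩
  intro j hj Y e
  obtain ⟨j, rfl⟩ : ∃ k, j = 1 + k := ⟨j - 1, by lia⟩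
  rw [← mk₀_tr_tr hle2 (hle1.trans hBJ)]
  set e1 := (Ext.mk₀ (tr (hle1.trans hBJ))).comp e (zero_add _) with he1
  have h0 : (Ext.mk₀ (tr (le_sup_left : B1 ≤ B1 ⊔ Ideal.span {x ^ t}))).comp e1 (zero_add _) = 0 := by
    rw [he1, mk₀_tr_tr, ← mk₀_tr_tr h1 (le_sup_left.trans hBJ)]
    exact H1 _ (by lia) _ _
  obtain ⟨f, hf⟩ := Ext.contravariant_sequence_exact₃ (KS_exact B1 (x ^ t)) _ e1 h0 rfl
  rw [← hf]
  have hnat := (KS_exact B2 (x ^ t')).extClass_naturality (KS_exact B1 (x ^ t)) (KS_map h2 x ht)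
  have hnat' := congr(Ext.comp $hnat f rfl)
  rw [Ext.comp_assoc _ _ _ (zero_add _) rfl (by lia)] at hnat'
  refine hnat'.symm.trans ?_
  rw [Ext.comp_assoc _ _ _ (add_zero _) (zero_add _) (by lia), hαβ, ← Ext.mk₀_comp_mk₀_assoc, ← Ext.mk₀_comp_mk₀_assoc,
    H2 _ (by lia), Ext.comp_zero, Ext.comp_zero]

theorem exists_PV [IsNoetherianRing R] (a : Ideal R) : ∃ n, PV a n := by
  classical
  obtain ⟨s, rfl⟩ := (IsNoetherian.noetherian a : a.FG)
  induction s using Finset.induction_on with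
  | empty => 
    refine ⟨0, ?_⟩
    rw [Finset.coe_empty, Submodule.span_empty]
    exact PV.bot
  | insert x s _ ih =>
    obtain ⟨n, hn⟩ := ih
    refine ⟨n + 1, ?_⟩
    rw [Finset.coe_insert, Submodule.span_insert, sup_comm]
    exact hn.step x

theorem exists_LCZ [IsNoetherianRing R] (a : Ideal R) : ∃ n, ∀ j > n, ∀ Y : ModuleCat.{u} R, LCZ a j Y := by
  obtain ⟨n, hn⟩ := exists_PV a
  refine ⟨n, fun j hj Y t e => ?_⟩
  obtain ⟨J', hJ', h, H⟩ := hn (a ^ (t+1)) (by rw [Ideal.radical_pow a (by lia)]; exact Ideal.le_radical)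
  obtain ⟨k, hk⟩ := Ideal.exists_pow_le_of_le_radical_of_fg hJ' (IsNoetherian.noetherian _)
  have h2 : a ^ (k + t) ≤ J' := (Ideal.pow_le_pow_right (by lia)).trans hk
  have h3 : a ^ (t+1) ≤ a ^ t := Ideal.pow_le_pow_right (by lia)
  refine ⟨k + t, by lia, ?_⟩
  rw [← mk₀_tr_tr h2 (h.trans h3), ← mk₀_tr_tr h h3, H j hj, Ext.comp_zero]
end les
section main
variable {R : Type u} [CommRing R]
open Abelian

theorem mkSE {A B C : Type u} [AddCommGroup A] [AddCommGroup B] [AddCommGroup C] [Module R A] [Module R B] [Module R C]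
    (f : A →ₗ[R] B) (g : B →ₗ[R] C) (hf : Function.Injective f) (hg : Function.Surjective g) (h : Function.Exact f g) :
    (ShortComplex.mk (ModuleCat.ofHom f) (ModuleCat.ofHom g) (by ext x; exact h.apply_apply_eq_zero x)).ShortExact where
  exact := by
    rw [ShortComplex.moduleCat_exact_iff]
    intro x hx
    exact (h x).1 hx
  mono_f := (ModuleCat.mono_iff_injective _).2 hf
  epi_g := (ModuleCat.epi_iff_surjective _).2 hg

/-- unbundled vanishing -/
abbrev LZ (I : Ideal R) (j : ℕ) (A : Type u) [AddCommGroup A] [Module R A] : Prop := LCZ I j (ModuleCat.of R A)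

variable {A B C : Type u} [AddCommGroup A] [AddCommGroup B] [AddCommGroup C] [Module R A] [Module R B] [Module R C]

theorem LZ.mid (f : A →ₗ[R] B) (g : B →ₗ[R] C) (hf : Function.Injective f) (hg : Function.Surjective g) (h : Function.Exact f g)
    {I : Ideal R} {j : ℕ} (h1 : LZ I j A) (h3 : LZ I j C) : LZ I j B :=
  LCZ.mid (mkSE f g hf hg h) h1 h3

theorem LZ.right (f : A →ₗ[R] B) (g : B →ₗ[R] C) (hf : Function.Injective f) (hg : Function.Surjective g) (h : Function.Exact f g)
    {I : Ideal R} {j : ℕ} (h1 : LZ I j B) (h3 : LZ I (j+1) A) : LZ I j C :=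
  LCZ.right (mkSE f g hf hg h) h1 h3

theorem LZ.zero [Subsingleton A] (I : Ideal R) (j : ℕ) : LZ I j A := by
  intro t e
  refine ⟨t, le_rfl, ?_⟩
  have hz : Limits.IsZero (ModuleCat.of R A) := ModuleCat.isZero_of_subsingleton _
  have : e = 0 := by
    rw [← Ext.comp_mk₀_id e, hz.eq_of_src (𝟙 _) 0, Ext.mk₀_zero, Ext.comp_zero]
  rw [this, Ext.comp_zero]

theorem LZ.equiv (f : A ≃ₗ[R] B) {I : Ideal R} {j : ℕ} (h : LZ I j A) : LZ I j B :=
  LZ.mid (C := PUnit) f.toLinearMap 0 f.injective (fun _ => ⟨0, rfl⟩)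
   (fun x => ⟨fun _ => f.surjective x, fun _ => rfl⟩) h (LZ.zero I j)

theorem LZ.filt [IsNoetherianRing R] {I : Ideal R} {j : ℕ} (b : Ideal R) (hb : ∀ p : Ideal R, p.IsPrime → b ≤ p → LZ I j (R ⧸ p))
    (K : Type u) [AddCommGroup K] [Module R K] [Module.Finite R K] (hK : b ≤ Module.annihilator R K) : LZ I j K := by
  revert hK
  refine IsNoetherianRing.induction_on_isQuotientEquivQuotientPrime R
    (motive := fun K _ _ _ => b ≤ Module.annihilator R K → LZ I j K) ‹Module.Finite R K› ?_ ?_ ?_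
  · intro N _ _ _ _ _
    exact LZ.zero I j
  · intro N _ _ _ p e h
    refine LZ.equiv e.symm (hb _ p.2 ?_)
    rw [e.annihilator_eq] at h
    rwa [Ideal.annihilator_quotient] at h
  · intro N₁ _ _ _ N₂ _ _ _ N₃ _ _ _ f g hf hg hfg h1 h3 h
    exact LZ.mid f g hf hg hfg (h1 (h.trans (f.annihilator_le_of_injective hf))) (h3 (h.trans (g.annihilator_le_of_surjective hg)))

theorem exists_hom [IsNoetherianRing R] (N : Type u) [AddCommGroup N] [Module R N] [Module.Finite R N] (p : Ideal R) [p.IsPrime]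
    (hp : Module.annihilator R N ≤ p) : ∃ f : N →ₗ[R] R ⧸ p, f ≠ 0 := by
  let D : Set (Submodule R N) := {K | ∀ s : R, (∀ n : N, s • n ∈ K) → s ∈ p}
  have hD : (⊥ : Submodule R N) ∈ D := by
    intro s hs
    exact hp (Module.mem_annihilator.2 fun n => by simpa using hs n)
  obtain ⟨N', hN', hmax⟩ := set_has_maximal_iff_noetherian.2 (inferInstance : IsNoetherian R N) D ⟨_, hD⟩
  have hmax' : ∀ K : Submodule R N, N' < K → ∃ s : R, s ∉ p ∧ ∀ n : N, s • n ∈ K := by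
    intro K hK
    by_contra! hcon
    refine hmax K (fun s hs => ?_) hK
    by_contra hsp
    obtain ⟨n, hn⟩ := hcon s hsp
    exact hn (hs n)
  obtain ⟨x, hx⟩ : ∃ x, x ∉ N' := by
    by_contra! hcon
    exact (Ideal.IsPrime.ne_top ‹_›) ((Ideal.eq_top_iff_one _).2 (hN' 1 fun n => hcon _))
  obtain ⟨s, hsp, hs⟩ := hmax' (N' ⊔ Submodule.span R {x}) (lt_of_le_of_ne le_sup_left fun h => hx (h ▸ Submodule.mem_sup_right (Submodule.mem_span_singleton_self x)))
  let φ : R →ₗ[R] N ⧸ N' := LinearMap.toSpanSingleton R _ (N'.mkQ x)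
  have hker : LinearMap.ker φ = p := by
    apply le_antisymm
    · intro r hr
      have hr : r • x ∈ N' := by
        rw [← Submodule.Quotient.mk_eq_zero]
        exact hr
      refine (Ideal.IsPrime.mem_or_mem ‹_› (hN' (r * s) fun n => ?_)).resolve_right hsp
      obtain ⟨a, ha, b, hb, hab⟩ := Submodule.mem_sup.1 (hs n)
      obtain ⟨c, rfl⟩ := Submodule.mem_span_singleton.1 hb
      rw [mul_smul, ← hab, smul_add, smul_comm r c]
      exact N'.add_mem (N'.smul_mem _ ha) (N'.smul_mem _ hr)
    · intro r hr
      by_contra hcon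
      have hlt : N' < N' ⊔ (Ideal.span {r} • ⊤ : Submodule R N) := by
        refine lt_of_le_of_ne le_sup_left fun h => hcon ?_
        have : r • x ∈ N' := h ▸ Submodule.mem_sup_right (Submodule.smul_mem_smul (Ideal.mem_span_singleton_self r) trivial)
        exact (Submodule.Quotient.mk_eq_zero N').2 this
      obtain ⟨s', hs'p, hs'⟩ := hmax' _ hlt
      have h1 : (⟨p, ‹_›⟩ : PrimeSpectrum R) ∈ Module.support R ((N ⧸ N') ⧸ (Ideal.span {r} • ⊤ : Submodule R (N ⧸ N'))) := by
        rw [Module.support_quotient]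
        refine ⟨?_, ?_⟩
        · rw [Module.mem_support_iff_of_finite]
          intro u hu
          refine hN' u fun n => ?_
          rw [← Submodule.Quotient.mk_eq_zero]
          exact Module.mem_annihilator.1 hu (N'.mkQ n)
        · rw [PrimeSpectrum.mem_zeroLocus]
          simpa using hr
      rw [Module.mem_support_iff_of_finite] at h1
      refine hs'p (h1 (Module.mem_annihilator.2 fun n => ?_))
      obtain ⟨n, rfl⟩ := Submodule.mkQ_surjective _ n
      obtain ⟨n, rfl⟩ := Submodule.mkQ_surjective _ n
      rw [← map_smul, ← map_smul]
      refine (Submodule.Quotient.mk_eq_zero _).2 ?_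
      obtain ⟨a, ha, b, hb, hab⟩ := Submodule.mem_sup.1 (hs' n)
      have h2 : N'.mkQ b ∈ Submodule.map N'.mkQ (Ideal.span {r} • ⊤ : Submodule R N) := Submodule.mem_map_of_mem hb
      rw [Submodule.map_smul''] at h2
      have h3 : N'.mkQ a = 0 := (Submodule.Quotient.mk_eq_zero _).2 ha
      rw [← hab, map_add, h3, zero_add]
      exact Submodule.smul_mono le_rfl le_top h2
  have hmem : ∀ n, (s • N'.mkQ) n ∈ LinearMap.range φ := by
    intro n
    obtain ⟨a, ha, b, hb, hab⟩ := Submodule.mem_sup.1 (hs n)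
    obtain ⟨c, rfl⟩ := Submodule.mem_span_singleton.1 hb
    have h3 : N'.mkQ a = 0 := (Submodule.Quotient.mk_eq_zero _).2 ha
    refine ⟨c, ?_⟩
    rw [LinearMap.smul_apply, ← map_smul, ← hab, map_add, h3, zero_add, map_smul]
    rfl
  let ψ : N →ₗ[R] LinearMap.range φ := LinearMap.codRestrict _ (s • N'.mkQ) hmem
  have hψ : ψ x ≠ 0 := by
    intro h
    have h : s • N'.mkQ x = 0 := congrArg Subtype.val h
    apply hsp
    rw [← hker]
    exact h
  refine ⟨(Submodule.quotEquivOfEq _ _ hker).toLinearMap ∘ₗ φ.quotKerEquivRange.symm.toLinearMap ∘ₗ ψ, fun h => hψ ?_⟩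
  have := congr($h x)
  simpa using this

theorem LZ.descend [IsNoetherianRing R] {I : Ideal R} {j : ℕ} (N : Type u) [AddCommGroup N] [Module R N] [Module.Finite R N]
    (hN : LZ I j N) (hj : ∀ p : Ideal R, p.IsPrime → Module.annihilator R N ≤ p → LZ I (j+1) (R ⧸ p)) :
    ∀ p : Ideal R, p.IsPrime → Module.annihilator R N ≤ p → LZ I j (R ⧸ p) := by
  intro p
  induction p using WellFoundedGT.induction with
  | ind p ih =>
  intro hp hNp
  obtain ⟨f, hf⟩ := exists_hom N p hNp
  have h1 : LZ I (j+1) (LinearMap.ker f) := LZ.filt _ hj _ ((LinearMap.ker f).subtype.annihilator_le_of_injective Subtype.val_injective)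
  have h2 : LZ I j (LinearMap.range f) := LZ.right (LinearMap.ker f).subtype f.rangeRestrict Subtype.val_injective f.surjective_rangeRestrict
    (LinearMap.exact_iff.2 (by simp)) hN h1
  have h3 : LZ I j ((R ⧸ p) ⧸ LinearMap.range f) := by
    refine LZ.filt (Module.annihilator R ((R ⧸ p) ⧸ LinearMap.range f)) (fun q hq hle => ?_) _ le_rfl
    have hpann : p ≤ Module.annihilator R ((R ⧸ p) ⧸ LinearMap.range f) := by
      refine le_trans ?_ ((LinearMap.range f).mkQ.annihilator_le_of_surjective (Submodule.mkQ_surjective _))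
      rw [Ideal.annihilator_quotient]
    refine ih q (lt_of_le_of_ne (hpann.trans hle) ?_) hq (hNp.trans (hpann.trans hle))
    rintro rfl
    apply hf
    ext n
    obtain ⟨r, hr⟩ := Submodule.mkQ_surjective _ (f n)
    have : r ∈ p := hle (Module.mem_annihilator.2 fun z => by
      obtain ⟨z, rfl⟩ := Submodule.mkQ_surjective _ z
      obtain ⟨z, rfl⟩ := Submodule.mkQ_surjective _ z
      rw [← map_smul]
      refine (Submodule.Quotient.mk_eq_zero _).2 ?_
      refine ⟨z • n, ?_⟩
      rw [map_smul, ← hr, ← map_smul, ← map_smul, smul_eq_mul, smul_eq_mul, mul_comm])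
    rw [← hr]
    exact (Submodule.Quotient.mk_eq_zero _).2 this
  exact LZ.mid (LinearMap.range f).subtype (LinearMap.range f).mkQ Subtype.val_injective (Submodule.mkQ_surjective _)
    (LinearMap.exact_iff.2 (by simp)) h2 h3

theorem LZ.support [IsNoetherianRing R] {I : Ideal R} {i : ℕ} (N : Type u) [AddCommGroup N] [Module R N] [Module.Finite R N]
    (hN : ∀ j > i, LZ I j N) (p : Ideal R) (hp : p.IsPrime) (hNp : Module.annihilator R N ≤ p) : ∀ j > i, LZ I j (R ⧸ p) := by
  obtain ⟨n, hn⟩ := exists_LCZ I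
  have key : ∀ k j, j > i → n < j + k → ∀ p : Ideal R, p.IsPrime → Module.annihilator R N ≤ p → LZ I j (R ⧸ p) := by
    intro k
    induction k with
    | zero => intro j _ hj p _ _; exact hn _ (by lia) _
    | succ k ih =>
      intro j hj hj'
      exact LZ.descend N (hN j hj) (ih (j+1) (by lia) (by lia))
  intro j hj
  exact key (n+1) j hj (by lia) p hp hNp

theorem cohDim_le_iff (I : Ideal R) (N : Type u) [AddCommGroup N] [Module R N] (i : ℕ) :
    cohDim I N ≤ (i : ℕ∞) ↔ ∀ j > i, LZ I j N := by
  rw [cohDim, sSup_le_iff]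
  constructor
  · intro h j hj
    obtain ⟨k, rfl⟩ : ∃ k, j = k + 1 := ⟨j - 1, by lia⟩
    rw [LZ, ← lcz_iff]
    intro hnz
    have := h _ ⟨_, rfl, hnz⟩
    norm_cast at this
    lia
  · rintro h _ ⟨j, rfl, hnz⟩
    by_contra hcon
    have hj : j > i := by
      by_contra hh
      apply hcon
      norm_cast
      lia
    obtain ⟨k, rfl⟩ : ∃ k, j = k + 1 := ⟨j - 1, by lia⟩
    exact ((lcz_iff _ _ _).2 (h _ hj)) hnz

theorem mem_ass_iff [IsNoetherianRing R] (M : Type u) [AddCommGroup M] [Module R M] (p : Ideal R) :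
    p ∈ associatedPrimes R M ↔ p.IsPrime ∧ ∃ x : M, ∀ r : R, r ∈ p ↔ r • x = 0 := by
  rw [AssociatedPrimes.mem_iff, isAssociatedPrime_iff]
  simp [SetLike.ext_iff, Submodule.mem_colon_singleton]

theorem LZ.sup_span (M : Type u) [AddCommGroup M] [Module R M] (Mi : Submodule R M) (p I : Ideal R) (j : ℕ) (y : M)
    (hy : ∀ r : R, r ∈ p ↔ r • y ∈ Mi) (h1 : LZ I j Mi) (h2 : LZ I j (R ⧸ p)) :
    LZ I j (Mi ⊔ Submodule.span R {y} : Submodule R M) := by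
  let N : Submodule R M := Mi ⊔ Submodule.span R {y}
  have hyN : y ∈ N := Submodule.mem_sup_right (Submodule.mem_span_singleton_self y)
  let f : Mi →ₗ[R] N := Submodule.inclusion le_sup_left
  let φ : R →ₗ[R] N ⧸ LinearMap.range f := LinearMap.toSpanSingleton R _ ((LinearMap.range f).mkQ ⟨y, hyN⟩)
  have hφ : ∀ r, φ r = Submodule.Quotient.mk (r • (⟨y, hyN⟩ : N)) := fun r => rfl
  have hrange : ∀ z : N, z ∈ LinearMap.range f ↔ (z : M) ∈ Mi := by
    intro z
    constructor
    · rintro ⟨w, rfl⟩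
      exact w.2
    · intro h
      exact ⟨⟨z, h⟩, rfl⟩
  have hker : LinearMap.ker φ = p := by
    ext r
    rw [LinearMap.mem_ker, hφ, Submodule.Quotient.mk_eq_zero, hrange, hy]
    rfl
  have hsurj : Function.Surjective φ := by
    intro z
    obtain ⟨⟨z, hz⟩, rfl⟩ := Submodule.mkQ_surjective _ z
    obtain ⟨a, ha, b, hb, hab⟩ := Submodule.mem_sup.1 hz
    obtain ⟨c, rfl⟩ := Submodule.mem_span_singleton.1 hb
    refine ⟨c, ?_⟩
    rw [hφ]
    refine (Submodule.Quotient.eq _).2 ((hrange _).2 ?_)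
    change c • y - z ∈ Mi
    rw [← hab]
    simpa using ha
  have e : (R ⧸ p) ≃ₗ[R] N ⧸ LinearMap.range f :=
    (Submodule.quotEquivOfEq _ _ hker.symm).trans (φ.quotKerEquivOfSurjective hsurj)
  exact LZ.mid f (LinearMap.range f).mkQ (Submodule.inclusion_injective _) (Submodule.mkQ_surjective _)
    (LinearMap.exact_iff.2 (by simp)) h1 (LZ.equiv e h2)

end main
end helpers

/-- `Ass_R (M / M_i) = {p ∈ Ass_R M : cd(𝔞, R/p) > i}` for `M_i` the largest submodule of
`M` with `cd(𝔞, M_i) ≤ i`. -/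
theorem stmt_4 {R : Type u} [CommRing R] [IsNoetherianRing R] (𝔞 : Ideal R)
    (M : Type u) [AddCommGroup M] [Module R M] [Module.Finite R M] [Nontrivial M]
    (c : ℕ) (hc : cohDim 𝔞 M = (c : ℕ∞)) (i : ℕ) (hi : i ≤ c)
    (Mi : Submodule R M) (hMi : cohDim 𝔞 ↥Mi ≤ (i : ℕ∞))
    (hMimax : ∀ L : Submodule R M, cohDim 𝔞 ↥L ≤ (i : ℕ∞) → L ≤ Mi) :
    associatedPrimes R (M ⧸ Mi) =
      {p ∈ associatedPrimes R M | ((i : ℕ∞) : WithBot ℕ∞) < cohDim 𝔞 (R ⧸ p)} := by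
  rw [cohDim_le_iff] at hMi
  ext p
  rw [Set.mem_setOf_eq, mem_ass_iff, mem_ass_iff, ← not_le, cohDim_le_iff]
  constructor
  · rintro ⟨hp, y, hy⟩
    obtain ⟨y, rfl⟩ := Submodule.mkQ_surjective _ y
    have hy : ∀ r : R, r ∈ p ↔ r • y ∈ Mi := by
      intro r
      rw [hy, ← map_smul]
      exact Submodule.Quotient.mk_eq_zero _
    have hcd : ¬ ∀ j > i, LZ 𝔞 j (R ⧸ p) := by
      intro h
      have h1 := hMimax (Mi ⊔ Submodule.span R {y}) ((cohDim_le_iff _ _ _).2 fun j hj =>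
        LZ.sup_span M Mi p 𝔞 j y hy (hMi j hj) (h j hj))
      refine hp.ne_top ((Ideal.eq_top_iff_one _).2 ((hy 1).2 ?_))
      rw [one_smul]
      exact h1 (Submodule.mem_sup_right (Submodule.mem_span_singleton_self y))
    refine ⟨⟨hp, ?_⟩, hcd⟩
    have hnle : ¬ Module.annihilator R Mi ≤ p := fun h => hcd (LZ.support Mi hMi p hp h)
    obtain ⟨s, hs, hsp⟩ := SetLike.not_le_iff_exists.1 hnle
    have hs' : ∀ m ∈ Mi, s • m = 0 := fun m hm => congrArg Subtype.val (Module.mem_annihilator.1 hs ⟨m, hm⟩)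
    refine ⟨s • y, fun r => ⟨fun hr => ?_, fun hr => ?_⟩⟩
    · rw [smul_comm]
      exact hs' _ ((hy r).1 hr)
    · rw [smul_smul] at hr
      refine (hp.mem_or_mem ((hy (r * s)).2 ?_)).resolve_right hsp
      rw [hr]
      exact Mi.zero_mem
  · rintro ⟨⟨hp, x, hx⟩, hcd⟩
    refine ⟨hp, Mi.mkQ x, fun r => ?_⟩
    have : r • Mi.mkQ x = 0 ↔ r • x ∈ Mi := by
      rw [← map_smul]
      exact Submodule.Quotient.mk_eq_zero _
    rw [this]
    refine ⟨fun hr => ?_, fun hr => ?_⟩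
    · rw [(hx r).1 hr]
      exact Mi.zero_mem
    · by_contra hrp
      refine hcd (LZ.support Mi hMi p hp fun s hs => ?_)
      have h0 : s • r • x = 0 := congrArg Subtype.val (Module.mem_annihilator.1 hs ⟨r • x, hr⟩)
      rw [smul_smul] at h0
      exact (hp.mem_or_mem ((hx _).2 h0)).resolve_right hrp
end
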